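/- Assume k = dim(affine span of K) ∈ {1,…,d−1} (so d_H = k) and that the dimension at infinity of K satisfies k_∞ = k. Let p > 1 and δ, δ' ≥ 0 with d − k + min(δ,δ') − p > 0. Then the optimal Hardy constant is μ_p(Ω) = ((d − k + min(δ,δ') − p)/p)^p. -/

import Mathlib

open MeasureTheory Set Filter

noncomputable section

/-- The optimal Hardy constant `μ_p(Ω)` for `Ω = ℝ^d \ K` with weight
`c_Ω = d_Γ^δ (1+d_Γ)^(δ'-δ)`. -/
def muP (d : ℕ) (p δ δ' : ℝ) (K : Set (EuclideanSpace ℝ (Fin d))) : ℝ :=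
  sInf { r : ℝ | ∃ φ : EuclideanSpace ℝ (Fin d) → ℝ,
    ContDiff ℝ 1 φ ∧ HasCompactSupport φ ∧ tsupport φ ⊆ Kᶜ ∧ φ ≠ 0 ∧
    r = (∫ x in Kᶜ,
          (Metric.infDist x K ^ δ * (1 + Metric.infDist x K) ^ (δ' - δ)) *
            ‖gradient φ x‖ ^ p) /
        (∫ x in Kᶜ,
          (Metric.infDist x K ^ δ * (1 + Metric.infDist x K) ^ (δ' - δ)) *
            Metric.infDist x K ^ (-p) * |φ x| ^ p) }

section geom
variable {E : Type*} [NormedAddCommGroup E] [InnerProductSpace ℝ E] [FiniteDimensional ℝ E]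

lemma hd_det_scale (U : Submodule ℝ E) (a b : ℝ) :
    (a • U.starProjection + b • Uᗮ.starProjection : E →L[ℝ] E).det
      = a ^ Module.finrank ℝ U * b ^ Module.finrank ℝ Uᗮ := by
  let e := U.prodEquivOfIsCompl _ U.isCompl_orthogonal
  have h : (e.symm : E →ₗ[ℝ] U × Uᗮ) ∘ₗ
      ((a • U.starProjection + b • Uᗮ.starProjection : E →L[ℝ] E) : E →ₗ[ℝ] E) ∘ₗ
      (e.symm.symm : U × Uᗮ →ₗ[ℝ] E) =
      LinearMap.prodMap (a • LinearMap.id) (b • LinearMap.id) := by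
    apply LinearMap.ext
    rintro ⟨u, v⟩
    have h1 : U.starProjection (u : E) = u := Submodule.starProjection_eq_self_iff.2 u.2
    have h2 : Uᗮ.starProjection (v : E) = v := Submodule.starProjection_eq_self_iff.2 v.2
    have h3 : U.starProjection (v : E) = 0 := (Submodule.starProjection_apply_eq_zero_iff _).2 v.2
    have h4 : Uᗮ.starProjection (u : E) = 0 :=
      (Submodule.starProjection_apply_eq_zero_iff _).2 (by simpa using u.2)
    rw [LinearMap.comp_apply, LinearEquiv.coe_coe, LinearEquiv.symm_apply_eq]
    simp [e, h1, h2, h3, h4]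
  rw [ContinuousLinearMap.det, ← LinearMap.det_conj _ e.symm, h, LinearMap.det_prodMap]
  simp

lemma hd_exists_proj {K : Set E} (hne : K.Nonempty) (hcl : IsClosed K) (hc : Convex ℝ K) :
    ∃ P : E → E, ∀ z, P z ∈ K ∧ Metric.infDist z K = ‖z - P z‖ ∧
      ∀ w ∈ K, inner ℝ (z - P z) (w - P z) ≤ 0 := by
  have : ∀ z, ∃ q, q ∈ K ∧ Metric.infDist z K = ‖z - q‖ ∧
      ∀ w ∈ K, inner ℝ (z - q) (w - q) ≤ 0 := by
    intro z
    obtain ⟨q, hq, h⟩ := exists_norm_eq_iInf_of_complete_convex hne hcl.isComplete hc z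
    refine ⟨q, hq, ?_, (norm_eq_iInf_iff_real_inner_le_zero hc hq).1 h⟩
    rw [h, Metric.infDist_eq_iInf]
    simp [dist_eq_norm]
  choose P hP using this
  exact ⟨P, hP⟩

/-- projection data -/
structure HdProj (K : Set E) (P : E → E) : Prop where
  mem : ∀ z, P z ∈ K
  dist : ∀ z, Metric.infDist z K = ‖z - P z‖
  inner_le : ∀ z, ∀ w ∈ K, inner ℝ (z - P z) (w - P z) ≤ 0

variable {K : Set E} {P : E → E}

lemma HdProj.unique (h : HdProj K P) {z q : E} (hq : q ∈ K)
    (hi : ∀ w ∈ K, inner ℝ (z - q) (w - q) ≤ 0) : P z = q := by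
  have h1 := h.inner_le z q hq
  have h2 := hi (P z) (h.mem z)
  have : inner ℝ (q - P z) (q - P z) ≤ (0:ℝ) := by
    have e : inner ℝ (q - P z) (q - P z) =
      inner ℝ (z - P z) (q - P z) + inner ℝ (z - q) (P z - q) := by
      simp only [inner_sub_left, inner_sub_right]; ring
    rw [e]; linarith
  rw [real_inner_self_eq_norm_sq] at this
  have h0 : ‖q - P z‖ = 0 := by nlinarith [norm_nonneg (q - P z)]
  exact (sub_eq_zero.1 (norm_eq_zero.1 h0)).symm

/-- radial scaling away from `K` -/
def hdS (P : E → E) (t : ℝ) (z : E) : E := P z + t • (z - P z)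

lemma HdProj.P_S (h : HdProj K P) {t : ℝ} (ht : 0 ≤ t) (z : E) : P (hdS P t z) = P z := by
  apply h.unique (h.mem z)
  intro w hw
  have := h.inner_le z w hw
  simp only [hdS, add_sub_cancel_left, inner_smul_left]
  simpa using mul_nonpos_of_nonneg_of_nonpos ht this

lemma HdProj.S_S (h : HdProj K P) {t s : ℝ} (ht : 0 ≤ t) (z : E) :
    hdS P s (hdS P t z) = hdS P (s * t) z := by
  rw [hdS, h.P_S ht]
  simp [hdS, smul_smul]

lemma hdS_one (z : E) : hdS P 1 z = z := by simp [hdS]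

lemma HdProj.infDist_S (h : HdProj K P) {t : ℝ} (ht : 0 ≤ t) (z : E) :
    Metric.infDist (hdS P t z) K = t * Metric.infDist z K := by
  rw [h.dist, h.dist, h.P_S ht, hdS, add_sub_cancel_left, norm_smul, Real.norm_of_nonneg ht]

lemma HdProj.norm_sub_le (h : HdProj K P) {U : Submodule ℝ E}
    (hU : ∀ a ∈ K, ∀ b ∈ K, a - b ∈ U) (z z' : E) :
    ‖P z - P z'‖ ≤ ‖U.starProjection (z - z')‖ := by
  have h1 := h.inner_le z (P z') (h.mem _)
  have h2 := h.inner_le z' (P z) (h.mem _)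
  have h3 : ‖P z - P z'‖ ^ 2 ≤ inner ℝ (z - z') (P z - P z') := by
    have e : inner ℝ (z - z') (P z - P z') - inner ℝ (P z - P z') (P z - P z') =
      - inner ℝ (z - P z) (P z' - P z) - inner ℝ (z' - P z') (P z - P z') := by
      simp only [inner_sub_left, inner_sub_right]; ring
    rw [← real_inner_self_eq_norm_sq]
    linarith
  have h4 : inner ℝ (z - z') (P z - P z') = inner ℝ (U.starProjection (z - z')) (P z - P z') := by
    rw [Submodule.inner_starProjection_left_eq_right,
      Submodule.starProjection_eq_self_iff.2 (hU _ (h.mem _) _ (h.mem _))]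
  rw [h4] at h3
  have h5 := real_inner_le_norm (U.starProjection (z - z')) (P z - P z')
  by_contra hlt
  push Not at hlt
  nlinarith [norm_nonneg (U.starProjection (z - z')), norm_nonneg (P z - P z')]

lemma HdProj.lipschitz (h : HdProj K P) : LipschitzWith 1 P := by
  apply LipschitzWith.of_dist_le_mul
  intro x y
  have := h.norm_sub_le (U := ⊤) (by simp) x y
  rw [Submodule.starProjection_top] at this
  simpa [dist_eq_norm] using this

/-- the nonexpansive part of the contraction -/
def hdG (P : E → E) (U : Submodule ℝ E) (s : ℝ) (z : E) : E :=
  P z + (s • U.starProjection (z - P z) + Uᗮ.starProjection (z - P z))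

lemma HdProj.lipschitz_G (h : HdProj K P) {U : Submodule ℝ E}
    (hU : ∀ a ∈ K, ∀ b ∈ K, a - b ∈ U) {s : ℝ} (hs : 0 ≤ s) (hs1 : s ≤ 1) :
    LipschitzWith 1 (hdG P U s) := by
  apply LipschitzWith.of_dist_le_mul
  intro x y
  simp only [NNReal.coe_one, one_mul, dist_eq_norm]
  have hm := hU _ (h.mem x) _ (h.mem y)
  have e1 : U.starProjection (P x - P y) = P x - P y := Submodule.starProjection_eq_self_iff.2 hm
  have e2 : Uᗮ.starProjection (P x - P y) = 0 :=
      (Submodule.starProjection_apply_eq_zero_iff _).2 (by simpa using hm)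
  have f1 : ∀ v, U.starProjection (U.starProjection v) = U.starProjection v := fun v =>
    Submodule.starProjection_eq_self_iff.2 (by simp)
  have f2 : ∀ v, Uᗮ.starProjection (Uᗮ.starProjection v) = Uᗮ.starProjection v := fun v =>
    Submodule.starProjection_eq_self_iff.2 (Submodule.starProjection_apply_mem _ _)
  have f3 : ∀ v, U.starProjection (Uᗮ.starProjection v) = 0 := fun v =>
    (Submodule.starProjection_apply_eq_zero_iff _).2 (Submodule.starProjection_apply_mem _ _)
  have f4 : ∀ v, Uᗮ.starProjection (U.starProjection v) = 0 := fun v =>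
    (Submodule.starProjection_apply_eq_zero_iff _).2 (by simp)
  have e3 : hdG P U s x - hdG P U s y = (1 - s) • (P x - P y) + s • U.starProjection (x - y)
      + Uᗮ.starProjection (x - y) := by
    have e1' := e1
    have e2' := e2
    simp only [map_sub] at e1' e2'
    have a1 : U.starProjection (P x) = U.starProjection (P y) + (P x - P y) := by
      rw [← e1']; abel
    have a2 : Uᗮ.starProjection (P x) = Uᗮ.starProjection (P y) := sub_eq_zero.1 e2'
    simp only [hdG, map_sub, a1, a2]
    module
  have n1 : U.starProjection (hdG P U s x - hdG P U s y) =
      (1 - s) • (P x - P y) + s • U.starProjection (x - y) := by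
    rw [e3]; simp only [map_add, map_smul, e1, f1, f3, add_zero]
  have n2 : Uᗮ.starProjection (hdG P U s x - hdG P U s y) = Uᗮ.starProjection (x - y) := by
    rw [e3]; simp only [map_add, map_smul, e2, f2, f4, smul_zero, zero_add]
  have n3 : ‖(1 - s) • (P x - P y) + s • U.starProjection (x - y)‖ ≤ ‖U.starProjection (x - y)‖ := by
    refine (norm_add_le _ _).trans ?_
    rw [norm_smul, norm_smul, Real.norm_of_nonneg hs, Real.norm_of_nonneg (sub_nonneg.2 hs1)]
    nlinarith [h.norm_sub_le hU x y, sub_nonneg.2 hs1]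
  have q1 := Submodule.norm_sq_eq_add_norm_sq_starProjection (hdG P U s x - hdG P U s y) U
  have q2 := Submodule.norm_sq_eq_add_norm_sq_starProjection (x - y) U
  rw [n1, n2] at q1
  refine abs_le_of_sq_le_sq' ?_ (norm_nonneg _) |>.2
  nlinarith [norm_nonneg ((1 - s) • (P x - P y) + s • U.starProjection (x - y))]

lemma HdProj.S_eq (h : HdProj K P) {U : Submodule ℝ E}
    (hU : ∀ a ∈ K, ∀ b ∈ K, a - b ∈ U) {x0 : E} (hx0 : x0 ∈ K) (s : ℝ) (z : E) :
    hdS P s z = x0 + ((1:ℝ) • U.starProjection + s • Uᗮ.starProjection : E →L[ℝ] E)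
      (hdG P U s z - x0) := by
  have hm := hU _ (h.mem z) _ hx0
  have e1 : U.starProjection (P z - x0) = P z - x0 := Submodule.starProjection_eq_self_iff.2 hm
  have e2 : Uᗮ.starProjection (P z - x0) = 0 :=
      (Submodule.starProjection_apply_eq_zero_iff _).2 (by simpa using hm)
  have f1 : ∀ v, U.starProjection (U.starProjection v) = U.starProjection v := fun v =>
    Submodule.starProjection_eq_self_iff.2 (by simp)
  have f2 : ∀ v, Uᗮ.starProjection (Uᗮ.starProjection v) = Uᗮ.starProjection v := fun v =>
    Submodule.starProjection_eq_self_iff.2 (Submodule.starProjection_apply_mem _ _)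
  have f3 : ∀ v, U.starProjection (Uᗮ.starProjection v) = 0 := fun v =>
    (Submodule.starProjection_apply_eq_zero_iff _).2 (Submodule.starProjection_apply_mem _ _)
  have f4 : ∀ v, Uᗮ.starProjection (U.starProjection v) = 0 := fun v =>
    (Submodule.starProjection_apply_eq_zero_iff _).2 (by simp)
  have e3 : hdG P U s z - x0 = (P z - x0) + (s • U.starProjection (z - P z) +
      Uᗮ.starProjection (z - P z)) := by rw [hdG]; abel
  have e4 := U.starProjection_add_starProjection_orthogonal (z - P z)
  rw [e3]
  rw [hdS]
  have e5 : s • (z - P z) = s • U.starProjection (z - P z) + s • Uᗮ.starProjection (z - P z) := by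
    rw [← smul_add, e4]
  rw [e5]
  generalize z - P z = v at *
  simp only [add_apply, smul_apply, map_add, map_smul, e1, e2, f1, f2, f3, f4]
  module
end geom

lemma hd_lint_rpow {M : ℝ} (hM : 1 < M) :
    ∫⁻ t in Ioi (1:ℝ), ENNReal.ofReal (t ^ (-M)) = ENNReal.ofReal ((M - 1)⁻¹) := by
  rw [← ofReal_integral_eq_lintegral_ofReal]
  · rw [integral_Ioi_rpow_of_lt (by linarith) one_pos]
    congr 1
    rw [Real.one_rpow, ← neg_div_neg_eq]
    simp; ring
  · exact integrableOn_Ioi_rpow_of_lt (by linarith) one_pos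
  · filter_upwards [self_mem_ae_restrict measurableSet_Ioi] with t ht
    have : (0:ℝ) < t := lt_trans one_pos ht
    positivity

lemma hd_holder {p M : ℝ} (hp : 1 < p) (hM : 1 < M) {g : ℝ → ENNReal} (hg : Measurable g) :
    (∫⁻ t in Ioi (1:ℝ), g t) ^ p ≤ ENNReal.ofReal ((M - 1)⁻¹) ^ (p - 1) *
      ∫⁻ t in Ioi (1:ℝ), g t ^ p * ENNReal.ofReal (t ^ (M * (p - 1))) := by
  have hp0 : 0 < p := by linarith
  have hpq : p.HolderConjugate (p / (p - 1)) := Real.HolderConjugate.conjExponent hp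
  set a := M * (p - 1) / p with ha
  have h1 := ENNReal.lintegral_mul_le_Lp_mul_Lq (volume.restrict (Ioi (1:ℝ))) hpq
    (f := fun t => g t * ENNReal.ofReal (t ^ a)) (g := fun t => ENNReal.ofReal (t ^ (-a)))
    (by fun_prop) (by fun_prop)
  have h2 : ∫⁻ t in Ioi (1:ℝ), ((fun t => g t * ENNReal.ofReal (t ^ a)) *
      fun t => ENNReal.ofReal (t ^ (-a))) t = ∫⁻ t in Ioi (1:ℝ), g t := by
    apply setLIntegral_congr_fun measurableSet_Ioi
    intro t ht
    have ht0 : (0:ℝ) < t := lt_trans one_pos ht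
    simp only [Pi.mul_apply]
    rw [mul_assoc, ← ENNReal.ofReal_mul (by positivity), ← Real.rpow_add ht0]
    simp
  have h3 : ∫⁻ t in Ioi (1:ℝ), (ENNReal.ofReal (t ^ (-a))) ^ (p / (p - 1)) =
      ENNReal.ofReal ((M - 1)⁻¹) := by
    rw [← hd_lint_rpow hM]
    apply setLIntegral_congr_fun measurableSet_Ioi
    intro t ht
    have ht0 : (0:ℝ) < t := lt_trans one_pos ht
    have : p - 1 ≠ 0 := by linarith
    simp only
    rw [ENNReal.ofReal_rpow_of_pos (by positivity), ← Real.rpow_mul ht0.le]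
    congr 2
    rw [ha]; field_simp
  have h4 : ∫⁻ t in Ioi (1:ℝ), (g t * ENNReal.ofReal (t ^ a)) ^ p =
      ∫⁻ t in Ioi (1:ℝ), g t ^ p * ENNReal.ofReal (t ^ (M * (p - 1))) := by
    apply setLIntegral_congr_fun measurableSet_Ioi
    intro t ht
    have ht0 : (0:ℝ) < t := lt_trans one_pos ht
    simp only
    rw [ENNReal.mul_rpow_of_nonneg _ _ hp0.le, ENNReal.ofReal_rpow_of_pos (by positivity),
      ← Real.rpow_mul ht0.le]
    congr 3
    rw [ha]; field_simp
  rw [h2, h3, h4] at h1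
  calc _ ≤ _ := ENNReal.rpow_le_rpow h1 hp0.le
    _ = _ := by
      rw [ENNReal.mul_rpow_of_nonneg _ _ hp0.le, ← ENNReal.rpow_mul, ← ENNReal.rpow_mul]
      have e1 : 1 / p * p = 1 := by field_simp
      have e2 : 1 / (p / (p - 1)) * p = p - 1 := by field_simp
      rw [e1, e2, ENNReal.rpow_one, mul_comm]

section geom
variable {E : Type*} [NormedAddCommGroup E] [InnerProductSpace ℝ E] [FiniteDimensional ℝ E]
  [MeasurableSpace E] [BorelSpace E]
variable {K : Set E} {P : E → E}

lemma hd_vol_lip (μ : Measure E) [μ.IsAddHaarMeasure] {G : E → E} (hG : LipschitzWith 1 G)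
    (B : Set E) : μ (G '' B) ≤ μ B := by
  have e : μ = μ.addHaarScalarFactor μH[(Module.finrank ℝ E : ℝ)] • μH[(Module.finrank ℝ E : ℝ)] :=
    Measure.isAddLeftInvariant_eq_smul _ _
  rw [e]
  simp only [Measure.smul_apply, ENNReal.smul_def, smul_eq_mul]
  refine mul_le_mul_right ?_ _
  simpa using hG.hausdorffMeasure_image_le (Nat.cast_nonneg (Module.finrank ℝ E)) B

lemma HdProj.vol_S_le (μ : Measure E) [μ.IsAddHaarMeasure] (h : HdProj K P) {U : Submodule ℝ E}
    (hU : ∀ a ∈ K, ∀ b ∈ K, a - b ∈ U) {s : ℝ} (hs : 0 ≤ s) (hs1 : s ≤ 1) (B : Set E) :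
    μ (hdS P s '' B) ≤ ENNReal.ofReal (s ^ Module.finrank ℝ Uᗮ) * μ B := by
  set L : E →L[ℝ] E := (1:ℝ) • U.starProjection + s • Uᗮ.starProjection
  have hx := h.mem 0
  have : hdS P s '' B = (fun x => P 0 + x) '' (L '' ((fun x => -P 0 + x) '' (hdG P U s '' B))) := by
    simp only [image_image]
    apply image_congr
    intro z _
    rw [h.S_eq hU hx, neg_add_eq_sub]
  rw [this, image_add_left, measure_preimage_add, Measure.addHaar_image_continuousLinearMap,
    image_add_left, measure_preimage_add]
  have hdet : LinearMap.det (L : E →ₗ[ℝ] E) = s ^ Module.finrank ℝ Uᗮ := by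
    have := hd_det_scale U 1 s
    rw [one_pow, one_mul] at this
    exact this
  rw [hdet, abs_of_nonneg (pow_nonneg hs _)]
  refine mul_le_mul_right ?_ _
  exact hd_vol_lip μ (h.lipschitz_G hU hs hs1) B

lemma HdProj.cont_S (h : HdProj K P) : Continuous (fun q : ℝ × E => hdS P q.1 q.2) := by
  have := h.lipschitz.continuous
  unfold hdS
  fun_prop

lemma HdProj.lintegral_S (μ : Measure E) [μ.IsAddHaarMeasure] (h : HdProj K P) {U : Submodule ℝ E}
    (hU : ∀ a ∈ K, ∀ b ∈ K, a - b ∈ U) {t : ℝ} (ht : 1 ≤ t) {f : E → ENNReal} (hf : Measurable f) :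
    ∫⁻ z, f (hdS P t z) ∂μ ≤ ENNReal.ofReal (t ^ (-(Module.finrank ℝ Uᗮ : ℝ))) * ∫⁻ z, f z ∂μ := by
  have ht0 : 0 < t := by linarith
  have hm : Measurable (hdS P t) := (h.cont_S.comp (by fun_prop : Continuous fun z : E => (t, z))).measurable
  rw [← lintegral_map hf hm, ← smul_eq_mul, ← lintegral_smul_measure]
  refine lintegral_mono' ?_ le_rfl
  rw [Measure.le_iff]
  intro B hB
  rw [Measure.map_apply hm hB]
  have e : hdS P t ⁻¹' B ⊆ hdS P t⁻¹ '' B := by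
    intro z hz
    refine ⟨_, hz, ?_⟩
    rw [h.S_S ht0.le, inv_mul_cancel₀ ht0.ne', hdS_one]
  refine (measure_mono e).trans ((h.vol_S_le μ hU (by positivity) (inv_le_one_of_one_le₀ ht) B).trans ?_)
  rw [Measure.smul_apply, smul_eq_mul]
  gcongr
  rw [Real.rpow_neg ht0.le, Real.rpow_natCast, inv_pow]

lemma HdProj.pointwise (h : HdProj K P) {φ : E → ℝ} (hφ : ContDiff ℝ 1 φ) (hs : HasCompactSupport φ)
    {z : E} (hz : 0 < Metric.infDist z K) :
    ‖φ z‖ₑ ≤ ENNReal.ofReal (Metric.infDist z K) * ∫⁻ t in Ioi (1:ℝ), ‖fderiv ℝ φ (hdS P t z)‖ₑ := by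
  obtain ⟨R, hR⟩ := hs.isBounded.subset_closedBall 0
  rw [h.dist] at *
  obtain ⟨T, hT1, hT⟩ : ∃ T : ℝ, 1 ≤ T ∧ R + ‖P z‖ < T * ‖z - P z‖ := by
    refine ⟨max 1 ((R + ‖P z‖ + 1) / ‖z - P z‖), le_max_left _ _, ?_⟩
    calc R + ‖P z‖ < R + ‖P z‖ + 1 := by linarith
      _ = (R + ‖P z‖ + 1) / ‖z - P z‖ * ‖z - P z‖ := by field_simp
      _ ≤ _ := by gcongr; exact le_max_right _ _
  have hzero : φ (hdS P T z) = 0 := by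
    by_contra hne
    have := hR (subset_tsupport _ hne)
    rw [mem_closedBall_zero_iff] at this
    have h2 : ‖T • (z - P z)‖ ≤ ‖hdS P T z‖ + ‖P z‖ := by
      have : T • (z - P z) = hdS P T z - P z := by simp [hdS]
      rw [this]; exact _root_.norm_sub_le _ _
    rw [norm_smul, Real.norm_of_nonneg (by linarith)] at h2
    linarith
  have hd : ∀ t, HasDerivAt (fun t => φ (hdS P t z)) (fderiv ℝ φ (hdS P t z) (z - P z)) t := by
    intro t
    have h1 : HasDerivAt (fun t : ℝ => hdS P t z) (z - P z) t := by
      unfold hdS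
      simpa using ((hasDerivAt_id t).smul_const (z - P z)).const_add (P z)
    exact ((hφ.differentiable one_ne_zero _).hasFDerivAt).comp_hasDerivAt t h1
  have hc : ContDiff ℝ 1 (fun t => φ (hdS P t z)) := by
    refine hφ.comp ?_
    unfold hdS
    fun_prop
  have h1 := enorm_sub_le_lintegral_deriv_of_contDiffOn_Icc hc.contDiffOn hT1
  simp only [hzero, hdS_one, zero_sub, enorm_neg] at h1
  refine h1.trans ?_
  rw [Measure.restrict_congr_set Ioi_ae_eq_Ici, ← lintegral_const_mul' _ _ ENNReal.ofReal_ne_top]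
  refine lintegral_mono' (Measure.restrict_mono Icc_subset_Ici_self le_rfl) ?_
  intro t
  simp only
  rw [(hd t).deriv, ofReal_norm, mul_comm]
  exact ContinuousLinearMap.le_opENorm _ _

lemma HdProj.hardy (μ : Measure E) [μ.IsAddHaarMeasure] (h : HdProj K P) {U : Submodule ℝ E}
    (hU : ∀ a ∈ K, ∀ b ∈ K, a - b ∈ U) {p m M : ℝ} (hp : 1 < p) (hM : 1 < M)
    (hMp : M * p = m + Module.finrank ℝ Uᗮ) {c : ℝ → ℝ} (hcm : Measurable c) (hc0 : ∀ s, 0 ≤ s → 0 ≤ c s)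
    (hc : ∀ s t, 0 < s → 1 ≤ t → c s ≤ t ^ (-m) * c (t * s))
    {φ : E → ℝ} (hφ : ContDiff ℝ 1 φ) (hs : HasCompactSupport φ) :
    ∫⁻ z in {z | 0 < Metric.infDist z K}, ENNReal.ofReal (c (Metric.infDist z K) *
        Metric.infDist z K ^ (-p) * |φ z| ^ p) ∂μ ≤
      ENNReal.ofReal ((M - 1)⁻¹ ^ p) *
        ∫⁻ z, ENNReal.ofReal (c (Metric.infDist z K) * ‖fderiv ℝ φ z‖ ^ p) ∂μ := by
  have hp0 : 0 < p := by linarith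
  have hM1 : 0 < M - 1 := by linarith
  set A : ENNReal := ENNReal.ofReal ((M - 1)⁻¹) with hA
  have hfc : Continuous (fderiv ℝ φ) := hφ.continuous_fderiv one_ne_zero
  set F : E → ENNReal := fun z => ENNReal.ofReal (c (Metric.infDist z K) * ‖fderiv ℝ φ z‖ ^ p) with hF
  have hFm : Measurable F := by
    have h1 : Measurable (fun z : E => Metric.infDist z K) := (Metric.continuous_infDist_pt K).measurable
    have h2 := hfc.measurable
    fun_prop
  have hΩ : MeasurableSet {z | 0 < Metric.infDist z K} :=
    (isOpen_lt continuous_const (Metric.continuous_infDist_pt K)).measurableSet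
  -- pointwise
  have key : ∀ z ∈ {z | 0 < Metric.infDist z K}, ENNReal.ofReal (c (Metric.infDist z K) *
        Metric.infDist z K ^ (-p) * |φ z| ^ p) ≤ A ^ (p - 1) * ∫⁻ t in Ioi (1:ℝ),
          ENNReal.ofReal (t ^ (M * (p - 1))) * (ENNReal.ofReal (t ^ (-m)) * F (hdS P t z)) := by
    intro z hz
    have hz' : 0 < Metric.infDist z K := hz
    set ρ := Metric.infDist z K with hρ
    have h1 := h.pointwise hφ hs hz
    have hSz : Continuous (fun t : ℝ => hdS P t z) := by unfold hdS; fun_prop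
    have hgz : Measurable (fun t : ℝ => ‖fderiv ℝ φ (hdS P t z)‖ₑ) :=
      (hfc.comp hSz).enorm.measurable
    have h2 := hd_holder hp hM hgz
    have h3 : ENNReal.ofReal (|φ z| ^ p) ≤ ENNReal.ofReal (ρ ^ p) * (∫⁻ t in Ioi (1:ℝ), ‖fderiv ℝ φ (hdS P t z)‖ₑ) ^ p := by
      rw [← ENNReal.ofReal_rpow_of_nonneg (abs_nonneg _) hp0.le, ← Real.norm_eq_abs, ofReal_norm,
        ← ENNReal.ofReal_rpow_of_pos hz', ← ENNReal.mul_rpow_of_nonneg _ _ hp0.le]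
      exact ENNReal.rpow_le_rpow h1 hp0.le
    have hcρ := hc0 ρ hz'.le
    calc _ = ENNReal.ofReal (c ρ * ρ ^ (-p)) * ENNReal.ofReal (|φ z| ^ p) :=
          ENNReal.ofReal_mul (by positivity)
      _ ≤ ENNReal.ofReal (c ρ * ρ ^ (-p)) * (ENNReal.ofReal (ρ ^ p) * (A ^ (p - 1) *
            ∫⁻ t in Ioi (1:ℝ), ‖fderiv ℝ φ (hdS P t z)‖ₑ ^ p * ENNReal.ofReal (t ^ (M * (p - 1))))) := by
          refine mul_le_mul_right (h3.trans (mul_le_mul_right h2 _)) _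
      _ = A ^ (p - 1) * (ENNReal.ofReal (c ρ) *
            ∫⁻ t in Ioi (1:ℝ), ‖fderiv ℝ φ (hdS P t z)‖ₑ ^ p * ENNReal.ofReal (t ^ (M * (p - 1)))) := by
          rw [← mul_assoc (ENNReal.ofReal _) (ENNReal.ofReal _), ← ENNReal.ofReal_mul (by positivity), mul_assoc (c ρ),
            ← Real.rpow_add hz', neg_add_cancel, Real.rpow_zero, mul_one]
          ring
      _ ≤ _ := by
          gcongr
          rw [← lintegral_const_mul' _ _ ENNReal.ofReal_ne_top]
          refine setLIntegral_mono' measurableSet_Ioi ?_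
          intro t ht
          have ht1 : (1:ℝ) ≤ t := le_of_lt ht
          have ht0 : 0 < t := by linarith
          have e : F (hdS P t z) = ENNReal.ofReal (c (t * ρ)) * ‖fderiv ℝ φ (hdS P t z)‖ₑ ^ p := by
            simp only [hF]
            rw [h.infDist_S ht0.le, ENNReal.ofReal_mul (hc0 _ (by positivity)),
              ← ENNReal.ofReal_rpow_of_nonneg (norm_nonneg _) hp0.le, ofReal_norm]
          rw [e]
          calc _ ≤ ENNReal.ofReal (t ^ (-m) * c (t * ρ)) * (‖fderiv ℝ φ (hdS P t z)‖ₑ ^ p * ENNReal.ofReal (t ^ (M * (p - 1)))) := by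
                gcongr; exact hc ρ t hz' ht1
            _ = _ := by
                rw [ENNReal.ofReal_mul (by positivity)]; ring
  calc _ ≤ ∫⁻ z in {z | 0 < Metric.infDist z K}, (A ^ (p - 1) * ∫⁻ t in Ioi (1:ℝ),
          ENNReal.ofReal (t ^ (M * (p - 1))) * (ENNReal.ofReal (t ^ (-m)) * F (hdS P t z))) ∂μ :=
        setLIntegral_mono' hΩ key
    _ ≤ ∫⁻ z, (A ^ (p - 1) * ∫⁻ t in Ioi (1:ℝ),
          ENNReal.ofReal (t ^ (M * (p - 1))) * (ENNReal.ofReal (t ^ (-m)) * F (hdS P t z))) ∂μ :=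
        setLIntegral_le_lintegral _ _
    _ = A ^ (p - 1) * ∫⁻ t in Ioi (1:ℝ), ∫⁻ z,
          ENNReal.ofReal (t ^ (M * (p - 1))) * (ENNReal.ofReal (t ^ (-m)) * F (hdS P t z)) ∂μ := by
        rw [lintegral_const_mul' _ _ (ENNReal.rpow_ne_top_of_nonneg (by linarith) ENNReal.ofReal_ne_top)]
        congr 1
        apply lintegral_lintegral_swap
        apply Measurable.aemeasurable
        have hsw : Measurable (fun q : E × ℝ => hdS P q.2 q.1) :=
          (h.cont_S.comp (continuous_swap (X := E) (Y := ℝ))).measurable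
        have h1 : Measurable (fun q : E × ℝ => F (hdS P q.2 q.1)) := hFm.comp hsw
        have h2 : Measurable (fun q : E × ℝ => ENNReal.ofReal (q.2 ^ (M * (p - 1)))) := by fun_prop
        have h3 : Measurable (fun q : E × ℝ => ENNReal.ofReal (q.2 ^ (-m))) := by fun_prop
        exact h2.mul (h3.mul h1)
    _ ≤ A ^ (p - 1) * ∫⁻ t in Ioi (1:ℝ), ENNReal.ofReal (t ^ (-M)) * ∫⁻ z, F z ∂μ := by
        refine mul_le_mul_right ?_ _
        refine setLIntegral_mono' measurableSet_Ioi ?_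
        intro t ht
        have ht1 : (1:ℝ) ≤ t := le_of_lt ht
        have ht0 : 0 < t := by linarith
        rw [lintegral_const_mul' _ _ ENNReal.ofReal_ne_top, lintegral_const_mul' _ _ ENNReal.ofReal_ne_top]
        refine (mul_le_mul_right (mul_le_mul_right (h.lintegral_S μ hU ht1 hFm) _) _).trans_eq ?_
        rw [← mul_assoc, ← mul_assoc, ← ENNReal.ofReal_mul (by positivity), ← ENNReal.ofReal_mul (by positivity), ← Real.rpow_add ht0, ← Real.rpow_add ht0]
        congr 3
        linarith
    _ = A ^ (p - 1) * (A * ∫⁻ z, F z ∂μ) := by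
        rw [lintegral_mul_const _ (by fun_prop), hd_lint_rpow hM]
    _ = _ := by
        rw [← mul_assoc, ← ENNReal.ofReal_rpow_of_pos (by positivity), ← hA]
        congr 1
        have hA0 : A ≠ 0 := by rw [hA]; simpa using hM1
        conv_lhs => rw [← ENNReal.rpow_one A, ← ENNReal.rpow_mul, one_mul, ← ENNReal.rpow_add _ _ hA0 ENNReal.ofReal_ne_top]
        congr 1; ring

end geom

section balls
variable {F : Type*} [NormedAddCommGroup F] [InnerProductSpace ℝ F] [FiniteDimensional ℝ F]

lemma hd_slab [MeasurableSpace F] [BorelSpace F]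
    (ν : Measure F) [ν.IsAddHaarMeasure] {K : Set F} (hcl : IsClosed K) (hc : Convex ℝ K)
    (hk : 1 ≤ Module.finrank ℝ F) (v : F) :
    ∃ C : ℝ, 0 ≤ C ∧ ∀ R : ℝ, 1 ≤ R → ν ({x | x ∈ K ∧ x + v ∉ K} ∩ Metric.ball 0 R) ≤
      ENNReal.ofReal (C * R ^ (Module.finrank ℝ F - 1)) := by
  have hfin : ν (Metric.ball 0 1) ≠ ⊤ := measure_ball_lt_top.ne
  refine ⟨(1 + ‖v‖) ^ Module.finrank ℝ F * (ν (Metric.ball 0 1)).toReal, by positivity, ?_⟩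
  intro R hR
  set A : Set F := {x | x ∈ K ∧ x + v ∉ K} ∩ Metric.ball 0 R with hA
  have hAm : MeasurableSet A := by
    refine MeasurableSet.inter (hcl.measurableSet.inter ?_) measurableSet_ball
    exact (hcl.measurableSet.preimage (by fun_prop : Measurable fun x : F => x + v)).compl
  have hdisj : Pairwise (Function.onFun Disjoint (fun j : Fin ⌈R⌉₊ => (fun x => -((j:ℕ):ℝ) • v + x) ⁻¹' A)) := by
    have key : ∀ i j : ℕ, i < j → ∀ x y : F, x ∈ A → y ∈ A → x + (i:ℝ) • v = y + (j:ℝ) • v → False := by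
      intro i j hij x y hx hy hxy
      apply hy.1.2
      have hx' : x = y + ((j:ℝ) - i) • v := by
        have : x = y + (j:ℝ) • v - (i:ℝ) • v := by rw [← hxy]; abel
        rw [this]; module
      have h1 : (1:ℝ) ≤ (j:ℝ) - i := by
        have : (i:ℝ) + 1 ≤ j := by exact_mod_cast hij
        linarith
      have := hc.add_smul_sub_mem hy.1.1 hx.1.1 (t := ((j:ℝ) - i)⁻¹)
        ⟨by positivity, inv_le_one_of_one_le₀ h1⟩
      rw [hx', add_sub_cancel_left, smul_smul, inv_mul_cancel₀ (by linarith), one_smul] at this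
      exact this
    intro i j hij
    rw [Function.onFun, Set.disjoint_left]
    intro z hzi hzj
    simp only [mem_preimage] at hzi hzj
    rcases lt_or_gt_of_ne hij with h | h
    · exact key i j h _ _ hzi hzj (by module)
    · exact key j i h _ _ hzj hzi (by module)
  have hsub : (⋃ j : Fin ⌈R⌉₊, (fun x => -((j:ℕ):ℝ) • v + x) ⁻¹' A) ⊆ Metric.ball 0 (R * (1 + ‖v‖)) := by
    intro z hz
    simp only [mem_iUnion, mem_preimage] at hz
    obtain ⟨j, hj⟩ := hz
    have h1 := hj.2
    rw [mem_ball_zero_iff] at h1 ⊢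
    have hjR : ((j:ℕ):ℝ) ≤ R := (Nat.lt_ceil.1 j.2).le
    calc ‖z‖ = ‖(-((j:ℕ):ℝ) • v + z) + ((j:ℕ):ℝ) • v‖ := by congr 1; module
      _ ≤ ‖(-((j:ℕ):ℝ) • v + z)‖ + ‖((j:ℕ):ℝ) • v‖ := norm_add_le _ _
      _ < R + R * ‖v‖ := by
        rw [norm_smul ((j:ℕ):ℝ), Real.norm_of_nonneg (by positivity : (0:ℝ) ≤ ((j:ℕ):ℝ))]
        have := mul_le_mul_of_nonneg_right hjR (norm_nonneg v)
        linarith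
      _ = _ := by ring
  have hmeas := measure_mono (μ := ν) hsub
  rw [measure_iUnion hdisj (fun j => hAm.preimage (by fun_prop)), tsum_fintype] at hmeas
  simp only [measure_preimage_add, Finset.sum_const, Finset.card_univ, Fintype.card_fin] at hmeas
  have : Nontrivial F := Module.nontrivial_of_finrank_pos (R := ℝ) (by omega)
  rw [Measure.addHaar_ball _ _ (by positivity), nsmul_eq_mul] at hmeas
  have hRc : ENNReal.ofReal R ≤ (⌈R⌉₊ : ENNReal) := by
    rw [← ENNReal.ofReal_natCast]; exact ENNReal.ofReal_le_ofReal (Nat.le_ceil R)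
  have h2 : ENNReal.ofReal R * ν A ≤ ENNReal.ofReal ((R * (1 + ‖v‖)) ^ Module.finrank ℝ F) * ν (Metric.ball 0 1) :=
    (mul_le_mul_left hRc _).trans hmeas
  have hR0 : 0 < R := by linarith
  have e : ENNReal.ofReal ((R * (1 + ‖v‖)) ^ Module.finrank ℝ F) * ν (Metric.ball 0 1) =
      ENNReal.ofReal R * ENNReal.ofReal ((1 + ‖v‖) ^ Module.finrank ℝ F * (ν (Metric.ball 0 1)).toReal * R ^ (Module.finrank ℝ F - 1)) := by
    rw [← ENNReal.ofReal_mul hR0.le]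
    conv_lhs => rw [← ENNReal.ofReal_toReal hfin, ← ENNReal.ofReal_mul (by positivity)]
    congr 1
    obtain ⟨n, hn⟩ : ∃ n, Module.finrank ℝ F = n + 1 := ⟨_, (Nat.sub_add_cancel hk).symm⟩
    rw [hn, mul_pow, pow_succ R]; simp; ring
  rw [e] at h2
  exact (ENNReal.mul_le_mul_iff_right (by simpa using hR0) ENNReal.ofReal_ne_top).1 h2

lemma hd_cross {K : Set F} (hcl : IsClosed K) (hc : Convex ℝ K) {r : ℝ} (hr : 0 < r)
    (hk : 1 ≤ Module.finrank ℝ F)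
    {x : F} (h : ∃ u : F, ‖u‖ ≤ r ∧ x + u ∉ K) :
    ∃ q : Fin (Module.finrank ℝ F) × Bool,
      x + ((if q.2 then 1 else -1) * (Module.finrank ℝ F * r)) • stdOrthonormalBasis ℝ F q.1 ∉ K := by
  by_contra hcon
  push Not at hcon
  obtain ⟨u, hu, hxu⟩ := h
  obtain ⟨f, s, hf, hs⟩ := geometric_hahn_banach_closed_point hc hcl hxu
  set e := stdOrthonormalBasis ℝ F
  set t := (Module.finrank ℝ F : ℝ) * r
  have hk0 : (0:ℝ) < Module.finrank ℝ F := by exact_mod_cast hk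
  have ht : 0 < t := by positivity
  have hfe : ∀ i, |f (e i)| ≤ (s - f x) / t := by
    intro i
    have h1 := hf _ (hcon (i, true))
    have h2 := hf _ (hcon (i, false))
    simp at h1 h2
    rw [le_div_iff₀ ht]
    rcases abs_cases (f (e i)) with ⟨h, _⟩ | ⟨h, _⟩ <;> rw [h] <;> linarith
  have hui : ∀ i, |e.repr u i| ≤ r := by
    intro i
    rw [e.repr_apply_apply]
    refine (abs_real_inner_le_norm _ _).trans ?_
    simpa [e.norm_eq_one i] using hu
  have h1 : f u = ∑ i, e.repr u i * f (e i) := by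
    conv_lhs => rw [← e.sum_repr u]
    simp
  have h2 : f u ≤ ∑ i : Fin (Module.finrank ℝ F), r * ((s - f x) / t) := by
    rw [h1]
    apply Finset.sum_le_sum
    intro i _
    calc e.repr u i * f (e i) ≤ |e.repr u i * f (e i)| := le_abs_self _
      _ = |e.repr u i| * |f (e i)| := abs_mul _ _
      _ ≤ _ := mul_le_mul (hui i) (hfe i) (abs_nonneg _) hr.le
  rw [Finset.sum_const, Finset.card_univ, Fintype.card_fin, nsmul_eq_mul] at h2
  have h3 : (Module.finrank ℝ F : ℝ) * (r * ((s - f x) / t)) = s - f x := by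
    simp only [t]; field_simp
  rw [h3] at h2
  rw [map_add] at hs
  linarith

lemma hd_growth [MeasurableSpace F] [BorelSpace F]
    (ν : Measure F) [ν.IsAddHaarMeasure] {K : Set F} (hcl : IsClosed K) (hc : Convex ℝ K)
    (hk : 1 ≤ Module.finrank ℝ F) {r : ℝ} (hr : 0 < r)
    (h : ∀ x ∈ K, ∃ u : F, ‖u‖ ≤ r ∧ x + u ∉ K) :
    ∃ C : ℝ, 0 ≤ C ∧ ∀ R : ℝ, 1 ≤ R → ν (K ∩ Metric.ball 0 R) ≤
      ENNReal.ofReal (C * R ^ (Module.finrank ℝ F - 1)) := by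
  choose C hC0 hC using fun q : Fin (Module.finrank ℝ F) × Bool => hd_slab ν hcl hc hk
    (((if q.2 then 1 else -1) * (Module.finrank ℝ F * r)) • stdOrthonormalBasis ℝ F q.1)
  refine ⟨∑ q, C q, Finset.sum_nonneg fun q _ => hC0 q, ?_⟩
  intro R hR
  have hsub : K ∩ Metric.ball 0 R ⊆ ⋃ q : Fin (Module.finrank ℝ F) × Bool,
    ({x | x ∈ K ∧ x + ((if q.2 then 1 else -1) * (Module.finrank ℝ F * r)) • stdOrthonormalBasis ℝ F q.1 ∉ K} ∩ Metric.ball 0 R) := by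
    intro x hx
    obtain ⟨q, hq⟩ := hd_cross hcl hc hr hk (h x hx.1)
    exact mem_iUnion.2 ⟨q, ⟨hx.1, hq⟩, hx.2⟩
  refine (measure_mono hsub).trans ((measure_iUnion_fintype_le _ _).trans ?_)
  refine (Finset.sum_le_sum fun q _ => hC q R hR).trans_eq ?_
  rw [← ENNReal.ofReal_sum_of_nonneg, Finset.sum_mul]
  intro q _
  have := hC0 q
  positivity

end balls

lemma hd_bigballs {E : Type*} [NormedAddCommGroup E] [InnerProductSpace ℝ E] [FiniteDimensional ℝ E]
    [MeasurableSpace E] [BorelSpace E] {K : Set E} (hcl : IsClosed K) (hc : Convex ℝ K) {k : ℕ} (hk1 : 1 ≤ k)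
    {U : Submodule ℝ E} (hU : ∀ a ∈ K, ∀ b ∈ K, a - b ∈ U) (hk : Module.finrank ℝ U = k)
    (hne : K.Nonempty)
    (hkinf : Filter.liminf
        (fun r : ℝ =>
          Real.log ((μH[(k : ℝ)] (K ∩ Metric.ball 0 r)).toReal) / Real.log r)
        Filter.atTop = (k : ℝ)) {r : ℝ} (hr : 0 < r) :
    ∃ x ∈ K, ∀ u ∈ U, ‖u‖ ≤ r → x + u ∈ K := by
  by_contra hcon
  push Not at hcon
  obtain ⟨x0, hx0⟩ := hne
  set ι : U → E := fun u => x0 + u with hι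
  have hiso : Isometry ι := by
    apply Isometry.of_dist_eq
    intro a b
    simp [hι, dist_eq_norm]
  set K' : Set U := ι ⁻¹' K
  have hK'cl : IsClosed K' := hcl.preimage hiso.continuous
  have hK'c : Convex ℝ K' := by
    intro a ha b hb s t hs ht hst
    have := hc ha hb hs ht hst
    show ι _ ∈ K
    convert! this using 1
    simp only [hι, Submodule.coe_add, Submodule.coe_smul]
    have : x0 = (s + t) • x0 := by rw [hst, one_smul]
    conv_lhs => rw [this]
    module
  have hh : ∀ x ∈ K', ∃ u : U, ‖u‖ ≤ r ∧ x + u ∉ K' := by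
    intro x hx
    obtain ⟨u, hu, hur, hxu⟩ := hcon _ hx
    refine ⟨⟨u, hu⟩, hur, ?_⟩
    intro h
    apply hxu
    have : ι (x + ⟨u, hu⟩) ∈ K := h
    simpa [hι, add_assoc] using this
  obtain ⟨C, hC0, hC⟩ := hd_growth μH[(Module.finrank ℝ U : ℝ)] hK'cl hK'c (by omega) hr hh
  rw [hk] at hC
  have hb : ∀ R : ℝ, 1 ≤ R → (μH[(k : ℝ)] (K ∩ Metric.ball 0 R)) ≤
      ENNReal.ofReal (C * (R + ‖x0‖) ^ (k - 1)) := by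
    intro R hR
    refine le_trans ?_ (hC (R + ‖x0‖) (by linarith [norm_nonneg x0]))
    rw [← hiso.hausdorffMeasure_image (Or.inl (Nat.cast_nonneg k))]
    apply measure_mono
    intro z hz
    refine ⟨⟨z - x0, hU _ hz.1 _ hx0⟩, ⟨?_, ?_⟩, ?_⟩
    · show ι _ ∈ K
      simpa [hι] using hz.1
    · have := hz.2
      rw [mem_ball_zero_iff] at this ⊢
      show ‖z - x0‖ < _
      linarith [norm_sub_le z x0]
    · simp [hι]
  set D : ℝ := (C + 1) * (1 + ‖x0‖) ^ (k - 1) with hD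
  have hD1 : 1 ≤ D := by
    rw [hD]
    have : (1:ℝ) ≤ (1 + ‖x0‖) ^ (k - 1) := one_le_pow₀ (by linarith [norm_nonneg x0])
    nlinarith
  have hlog : ∀ R : ℝ, 1 < R → Real.log ((μH[(k : ℝ)] (K ∩ Metric.ball 0 R)).toReal) / Real.log R ≤
      Real.log D / Real.log R + ((k:ℝ) - 1) := by
    intro R hR
    have hlR : 0 < Real.log R := Real.log_pos hR
    have h1 : (μH[(k : ℝ)] (K ∩ Metric.ball 0 R)).toReal ≤ D * R ^ (k - 1) := by
      refine ENNReal.toReal_le_of_le_ofReal (by positivity) ((hb R hR.le).trans (ENNReal.ofReal_le_ofReal ?_))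
      rw [hD, mul_assoc, ← mul_pow]
      have : R + ‖x0‖ ≤ (1 + ‖x0‖) * R := by nlinarith [norm_nonneg x0]
      gcongr
      linarith
    have h2 : Real.log ((μH[(k : ℝ)] (K ∩ Metric.ball 0 R)).toReal) ≤ Real.log D + ((k:ℝ) - 1) * Real.log R := by
      have e : Real.log (D * R ^ (k - 1)) = Real.log D + ((k:ℝ) - 1) * Real.log R := by
        rw [Real.log_mul (by positivity) (by positivity), Real.log_pow]
        push_cast [hk1]; ring
      rcases eq_or_lt_of_le (ENNReal.toReal_nonneg (a := μH[(k : ℝ)] (K ∩ Metric.ball 0 R))) with h0 | h0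
      · rw [← h0, Real.log_zero, ← e]
        apply Real.log_nonneg
        have : (1:ℝ) ≤ R ^ (k - 1) := one_le_pow₀ hR.le
        nlinarith
      · rw [← e]
        exact Real.log_le_log h0 h1
    rw [div_add' _ _ _ hlR.ne']
    gcongr
  have htend : Tendsto (fun R : ℝ => Real.log D / Real.log R + ((k:ℝ) - 1)) atTop (nhds (0 + ((k:ℝ) - 1))) :=
    (Tendsto.div_atTop tendsto_const_nhds Real.tendsto_log_atTop).add_const _
  have hev : ∀ᶠ R : ℝ in atTop, Real.log ((μH[(k : ℝ)] (K ∩ Metric.ball 0 R)).toReal) / Real.log R ≤ (k:ℝ) - 1/2 := by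
    have := htend.eventually_lt_const (u := (k:ℝ) - 1/2) (by linarith)
    filter_upwards [this, eventually_gt_atTop (1:ℝ)] with R h1 h2
    exact (hlog R h2).trans h1.le
  have hkr : (1:ℝ) ≤ k := by exact_mod_cast hk1
  have : (k:ℝ) ≤ (k:ℝ) - 1/2 := by
    refine hkinf.symm.le.trans ?_
    rw [liminf_eq]
    apply Real.sSup_le
    · intro a ha
      obtain ⟨R, h1, h2⟩ := (ha.and hev).exists
      exact h1.trans h2
    · linarith
  linarith

section shell
variable {E : Type*} [NormedAddCommGroup E] [InnerProductSpace ℝ E] [FiniteDimensional ℝ E]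

/-- cylinder shells -/
def hdSh (U : Submodule ℝ E) (x0 : E) (L s1 s2 : ℝ) : Set E :=
  {z | ‖U.starProjection (z - x0)‖ ≤ L ∧ s1 ≤ ‖Uᗮ.starProjection (z - x0)‖ ∧
    ‖Uᗮ.starProjection (z - x0)‖ ≤ s2}

lemma hdSh_closed (U : Submodule ℝ E) (x0 : E) (L s1 s2 : ℝ) : IsClosed (hdSh U x0 L s1 s2) := by
  have h1 : IsClosed {z | ‖U.starProjection (z - x0)‖ ≤ L} := isClosed_le (by fun_prop) (by fun_prop)
  have h2 : IsClosed {z | s1 ≤ ‖Uᗮ.starProjection (z - x0)‖} := isClosed_le (by fun_prop) (by fun_prop)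
  have h3 : IsClosed {z | ‖Uᗮ.starProjection (z - x0)‖ ≤ s2} := isClosed_le (by fun_prop) (by fun_prop)
  exact h1.inter (h2.inter h3)

lemma hdSh_compact (U : Submodule ℝ E) (x0 : E) (L s1 s2 : ℝ) : IsCompact (hdSh U x0 L s1 s2) := by
  refine Metric.isCompact_of_isClosed_isBounded (hdSh_closed ..) ?_
  refine (Metric.isBounded_closedBall (x := x0) (r := L + s2)).subset ?_
  intro z hz
  rw [mem_closedBall_iff_norm]
  have e := U.starProjection_add_starProjection_orthogonal (z - x0)
  rw [← e]
  exact (norm_add_le _ _).trans (add_le_add hz.1 hz.2.2)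

/-- affine scaling -/
def hdT (U : Submodule ℝ E) (x0 : E) (a l : ℝ) (z : E) : E :=
  x0 + (a • U.starProjection + l • Uᗮ.starProjection : E →L[ℝ] E) (z - x0)

lemma hdT_X (U : Submodule ℝ E) (x0 : E) (a l : ℝ) (z : E) :
    U.starProjection (hdT U x0 a l z - x0) = a • U.starProjection (z - x0) := by
  have f1 : ∀ v, U.starProjection (U.starProjection v) = U.starProjection v := fun v =>
    Submodule.starProjection_eq_self_iff.2 (by simp)
  have f3 : ∀ v, U.starProjection (Uᗮ.starProjection v) = 0 := fun v =>
    (Submodule.starProjection_apply_eq_zero_iff _).2 (Submodule.starProjection_apply_mem _ _)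
  rw [hdT, add_sub_cancel_left]
  simp only [add_apply, smul_apply, map_add, map_smul, f1, f3, smul_zero, add_zero]

lemma hdT_Y (U : Submodule ℝ E) (x0 : E) (a l : ℝ) (z : E) :
    Uᗮ.starProjection (hdT U x0 a l z - x0) = l • Uᗮ.starProjection (z - x0) := by
  have f2 : ∀ v, Uᗮ.starProjection (Uᗮ.starProjection v) = Uᗮ.starProjection v := fun v =>
    Submodule.starProjection_eq_self_iff.2 (Submodule.starProjection_apply_mem _ _)
  have f4 : ∀ v, Uᗮ.starProjection (U.starProjection v) = 0 := fun v =>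
    (Submodule.starProjection_apply_eq_zero_iff _).2 (by simp)
  rw [hdT, add_sub_cancel_left]
  simp only [add_apply, smul_apply, map_add, map_smul, f2, f4, smul_zero, zero_add]

lemma hdT_inv (U : Submodule ℝ E) (x0 : E) {a l : ℝ} (ha : a ≠ 0) (hl : l ≠ 0) (z : E) :
    hdT U x0 a l (hdT U x0 a⁻¹ l⁻¹ z) = z := by
  conv_lhs => rw [hdT]
  simp only [add_apply, smul_apply, hdT_X, hdT_Y, smul_smul, mul_inv_cancel₀ ha, mul_inv_cancel₀ hl, one_smul]
  rw [U.starProjection_add_starProjection_orthogonal]; abel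

variable [MeasurableSpace E] [BorelSpace E]

lemma hd_shell_scale (μ : Measure E) [μ.IsAddHaarMeasure] (U : Submodule ℝ E) (x0 : E) {L s1 s2 a l : ℝ}
    (ha : 0 < a) (hl : 0 < l) (hs1 : 0 < s1) :
    ∫⁻ z in hdSh U x0 (a * L) (l * s1) (l * s2),
        ENNReal.ofReal (‖Uᗮ.starProjection (z - x0)‖ ^ (-(Module.finrank ℝ Uᗮ : ℝ))) ∂μ =
      ENNReal.ofReal (a ^ Module.finrank ℝ U) * ∫⁻ z in hdSh U x0 L s1 s2,
        ENNReal.ofReal (‖Uᗮ.starProjection (z - x0)‖ ^ (-(Module.finrank ℝ Uᗮ : ℝ))) ∂μ := by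
  have himg : hdSh U x0 (a * L) (l * s1) (l * s2) = hdT U x0 a l '' hdSh U x0 L s1 s2 := by
    ext z
    constructor
    · intro hz
      refine ⟨hdT U x0 a⁻¹ l⁻¹ z, ?_, hdT_inv U x0 ha.ne' hl.ne' z⟩
      simp only [hdSh, mem_ofPred_eq, hdT_X, hdT_Y, norm_smul, norm_inv, Real.norm_of_nonneg ha.le, Real.norm_of_nonneg hl.le] at hz ⊢
      refine ⟨?_, ?_, ?_⟩
      · rw [inv_mul_le_iff₀ ha]; exact hz.1
      · rw [le_inv_mul_iff₀ hl]; exact hz.2.1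
      · rw [inv_mul_le_iff₀ hl]; exact hz.2.2
    · rintro ⟨w, hw, rfl⟩
      simp only [hdSh, mem_ofPred_eq, hdT_X, hdT_Y, norm_smul, Real.norm_of_nonneg ha.le, Real.norm_of_nonneg hl.le] at hw ⊢
      exact ⟨by gcongr; exact hw.1, by gcongr; exact hw.2.1, by gcongr; exact hw.2.2⟩
  have hinj : Function.Injective (hdT U x0 a l) := by
    have := hdT_inv U x0 (inv_ne_zero ha.ne') (inv_ne_zero hl.ne')
    rw [inv_inv, inv_inv] at this
    exact Function.LeftInverse.injective this
  rw [himg, lintegral_image_eq_lintegral_abs_det_fderiv_mul μ (hdSh_closed ..).measurableSet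
    (f' := fun _ => (a • U.starProjection + l • Uᗮ.starProjection : E →L[ℝ] E)) _ hinj.injOn,
    ← lintegral_const_mul' _ _ ENNReal.ofReal_ne_top]
  · refine setLIntegral_congr_fun (hdSh_closed ..).measurableSet ?_
    intro z hz
    simp only
    rw [← ENNReal.ofReal_mul (abs_nonneg _), ← ENNReal.ofReal_mul (by positivity), hd_det_scale, hdT_Y, norm_smul,
      Real.norm_of_nonneg hl.le, abs_of_pos (by positivity), Real.mul_rpow hl.le (norm_nonneg _)]
    congr 1
    rw [Real.rpow_neg hl.le, Real.rpow_natCast]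
    field_simp
  · intro z _
    apply HasFDerivAt.hasFDerivWithinAt
    unfold hdT
    have := ((a • U.starProjection + l • Uᗮ.starProjection : E →L[ℝ] E).hasFDerivAt (x := z - x0)).comp z ((hasFDerivAt_id z).sub_const x0)
    exact this.const_add x0

lemma hd_shell_bound (μ : Measure E) [μ.IsAddHaarMeasure] (U : Submodule ℝ E) (x0 : E) {L s1 r : ℝ}
    (hs1 : 0 < s1) (hr : 1 ≤ r) :
    ∫⁻ z in hdSh U x0 (2 * L) s1 (s1 * r ^ 3),
        ENNReal.ofReal (‖Uᗮ.starProjection (z - x0)‖ ^ (-(Module.finrank ℝ Uᗮ : ℝ))) ∂μ ≤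
      ENNReal.ofReal (3 * 2 ^ Module.finrank ℝ U) * ∫⁻ z in hdSh U x0 L (s1 * r) (s1 * r ^ 2),
        ENNReal.ofReal (‖Uᗮ.starProjection (z - x0)‖ ^ (-(Module.finrank ℝ Uᗮ : ℝ))) ∂μ := by
  have hr0 : 0 < r := by linarith
  have hsub : hdSh U x0 (2 * L) s1 (s1 * r ^ 3) ⊆
      (hdSh U x0 (2 * L) (r⁻¹ * (s1 * r)) (r⁻¹ * (s1 * r ^ 2)) ∪ hdSh U x0 (2 * L) (1 * (s1 * r)) (1 * (s1 * r ^ 2)))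
      ∪ hdSh U x0 (2 * L) (r * (s1 * r)) (r * (s1 * r ^ 2)) := by
    rintro z ⟨h1, h2, h3⟩
    have e1 : r⁻¹ * (s1 * r) = s1 := by field_simp
    have e2 : r⁻¹ * (s1 * r ^ 2) = s1 * r := by field_simp
    have e3 : r * (s1 * r) = s1 * r ^ 2 := by ring
    have e4 : r * (s1 * r ^ 2) = s1 * r ^ 3 := by ring
    rw [e1, e2, e3, e4, one_mul, one_mul]
    rcases le_total ‖Uᗮ.starProjection (z - x0)‖ (s1 * r) with h | h
    · exact Or.inl (Or.inl ⟨h1, h2, h⟩)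
    rcases le_total ‖Uᗮ.starProjection (z - x0)‖ (s1 * r ^ 2) with h' | h'
    · exact Or.inl (Or.inr ⟨h1, h, h'⟩)
    · exact Or.inr ⟨h1, h', h3⟩
  refine (lintegral_mono_set hsub).trans ?_
  refine (lintegral_union_le _ _ _).trans ((add_le_add_left (lintegral_union_le _ _ _) _).trans ?_)
  have hsr : 0 < s1 * r := by positivity
  rw [hd_shell_scale μ U x0 two_pos (inv_pos.2 hr0) hsr, hd_shell_scale μ U x0 two_pos one_pos hsr,
    hd_shell_scale μ U x0 two_pos hr0 hsr, ENNReal.ofReal_mul (by norm_num)]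
  have : ENNReal.ofReal 3 = 3 := by simp
  rw [this]
  apply le_of_eq; ring
end shell

section testfn
variable {E : Type*} [NormedAddCommGroup E] [InnerProductSpace ℝ E] [FiniteDimensional ℝ E]

lemma hd_bump_bd {F : Type*} [NormedAddCommGroup F] [InnerProductSpace ℝ F] [FiniteDimensional ℝ F]
    {c : F} (η : ContDiffBump c) : ∃ C : ℝ, 0 < C ∧ ∀ z, ‖fderiv ℝ η z‖ ≤ C := by
  obtain ⟨C, hC⟩ := ContDiff.lipschitzWith_of_hasCompactSupport (𝕂 := ℝ) η.hasCompactSupport (η.contDiff (n := 1)) one_ne_zero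
  exact ⟨C + 1, by positivity, fun z => (norm_fderiv_le_of_lipschitz ℝ hC).trans (by simp)⟩

lemma hd_norm_starProjection_le (U : Submodule ℝ E) : ‖U.starProjection‖ ≤ 1 :=
  ContinuousLinearMap.opNorm_le_bound _ zero_le_one (fun z => by
    rw [one_mul]; exact Submodule.norm_starProjection_apply_le _ _)

lemma hd_test (U : Submodule ℝ E) : ∃ C : ℝ, 0 < C ∧ ∀ (x0 : E) (b N s1 L : ℝ), 0 < b → 0 < N → 0 < s1 → 0 < L →
    ∃ φ f : E → ℝ, ContDiff ℝ 1 φ ∧ tsupport φ ⊆ hdSh U x0 (2 * L) s1 (s1 * Real.exp N ^ 3) ∧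
      (∀ z, 0 ≤ f z ∧ f z ≤ 1) ∧ (∀ z ∈ hdSh U x0 L (s1 * Real.exp N) (s1 * Real.exp N ^ 2), f z = 1) ∧
      ContinuousOn f (hdSh U x0 (2 * L) s1 (s1 * Real.exp N ^ 3)) ∧
      (∀ z ∈ hdSh U x0 (2 * L) s1 (s1 * Real.exp N ^ 3), φ z = ‖Uᗮ.starProjection (z - x0)‖ ^ (-b) * f z) ∧
      (∀ z ∈ hdSh U x0 (2 * L) s1 (s1 * Real.exp N ^ 3), ‖fderiv ℝ φ z‖ ≤
        ‖Uᗮ.starProjection (z - x0)‖ ^ (-b - 1) * (b * f z + C / N + C * (‖Uᗮ.starProjection (z - x0)‖ / L))) := by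
  let η : ContDiffBump (0 : E) := ⟨1, 2, one_pos, by norm_num⟩
  let χ : ContDiffBump (3 / 2 : ℝ) := ⟨1 / 2, 3 / 2, by norm_num, by norm_num⟩
  obtain ⟨C1, hC1, hη⟩ := hd_bump_bd η
  obtain ⟨C2, hC2, hχ⟩ := hd_bump_bd χ
  refine ⟨C1 + C2, by positivity, ?_⟩
  intro x0 b N s1 L hb hN hs1 hL
  set R : E → ℝ := fun z => ‖Uᗮ.starProjection (z - x0)‖ with hR
  set A : E → ℝ := fun z => η (L⁻¹ • U.starProjection (z - x0)) with hA
  set D : E → ℝ := fun z => χ (Real.log (R z / s1) / N) with hD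
  have hA0 : ∀ z, 0 ≤ A z ∧ A z ≤ 1 := fun z => ⟨η.nonneg, η.le_one⟩
  have hD0 : ∀ z, 0 ≤ D z ∧ D z ≤ 1 := fun z => ⟨χ.nonneg, χ.le_one⟩
  have hR0 : ∀ z, 0 ≤ R z := fun z => norm_nonneg _
  have hRlip : LipschitzWith 1 R := by
    apply LipschitzWith.of_dist_le_mul
    intro x y
    rw [NNReal.coe_one, one_mul, Real.dist_eq, dist_eq_norm]
    refine (abs_norm_sub_norm_le _ _).trans ?_
    rw [← map_sub, sub_sub_sub_cancel_right]
    exact Submodule.norm_starProjection_apply_le _ _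
  -- log facts
  have hDsupp : ∀ z, D z ≠ 0 → s1 < R z ∧ R z < s1 * Real.exp N ^ 3 := by
    intro z hz
    have h1 : Real.log (R z / s1) / N ∈ Function.support χ := hz
    rw [χ.support_eq, Metric.mem_ball, Real.dist_eq, abs_lt] at h1
    have h1a : 0 < Real.log (R z / s1) / N := by
      have := h1.1
      change -(3/2 : ℝ) < _ at this
      linarith
    have h1b : Real.log (R z / s1) / N < 3 := by
      have := h1.2
      change _ < (3/2 : ℝ) at this
      linarith
    rw [lt_div_iff₀ hN, zero_mul] at h1a
    rw [div_lt_iff₀ hN] at h1b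
    have hpos : 0 < R z / s1 := by
      rcases (div_nonneg (hR0 z) hs1.le).lt_or_eq with h | h
      · exact h
      · rw [← h] at h1a; simp at h1a
    constructor
    · have := (Real.log_pos_iff hpos.le).1 h1a
      rwa [one_lt_div hs1] at this
    · have := (Real.log_lt_iff_lt_exp hpos).1 h1b
      rw [div_lt_iff₀ hs1] at this
      rw [← Real.exp_nat_mul, mul_comm]; exact_mod_cast this
  have hAsupp : ∀ z, A z ≠ 0 → ‖U.starProjection (z - x0)‖ ≤ 2 * L := by
    intro z hz
    have h1 : L⁻¹ • U.starProjection (z - x0) ∈ Function.support η := hz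
    rw [η.support_eq, mem_ball_zero_iff, norm_smul, norm_inv, Real.norm_of_nonneg hL.le, inv_mul_lt_iff₀ hL] at h1
    change _ < L * 2 at h1
    linarith
  -- derivatives
  have hAd : ∀ z, ∃ A' : E →L[ℝ] ℝ, HasFDerivAt A A' z ∧ ‖A'‖ ≤ C1 / L := by
    intro z
    have h1 : HasFDerivAt (fun z => L⁻¹ • U.starProjection (z - x0)) (L⁻¹ • U.starProjection) z := by
      have := (U.starProjection.hasFDerivAt (x := z - x0)).comp z ((hasFDerivAt_id z).sub_const x0)
      exact this.const_smul L⁻¹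
    have h2 := ((η.contDiff (n := 1)).differentiable one_ne_zero (L⁻¹ • U.starProjection (z - x0))).hasFDerivAt
    have h5 := HasFDerivAt.comp z h2 h1
    refine ⟨_, h5, (ContinuousLinearMap.opNorm_comp_le _ _).trans ?_⟩
    rw [norm_smul, norm_inv, Real.norm_of_nonneg hL.le, div_eq_mul_inv]
    have := hd_norm_starProjection_le U
    calc _ ≤ C1 * (L⁻¹ * 1) := by gcongr; exact hη _
      _ = _ := by ring
  have hRc : ∀ z, 0 < R z → ContDiffAt ℝ 1 R z := by
    intro z hz
    refine ContDiffAt.norm ℝ ?_ (norm_pos_iff.1 hz)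
    fun_prop
  have hRd : ∀ z, 0 < R z → ∃ R' : E →L[ℝ] ℝ, HasFDerivAt R R' z ∧ ‖R'‖ ≤ 1 := by
    intro z hz
    refine ⟨_, ((hRc z hz).differentiableAt one_ne_zero).hasFDerivAt, ?_⟩
    simpa using norm_fderiv_le_of_lipschitz ℝ hRlip
  have hDc : ∀ z, 0 < R z → ContDiffAt ℝ 1 D z := by
    intro z hz
    refine χ.contDiff.contDiffAt.comp z ?_
    refine ContDiffAt.div_const (ContDiffAt.log ((hRc z hz).div_const _) ?_) _
    positivity
  have hAc : ContDiff ℝ 1 A := by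
    refine η.contDiff.comp ?_
    fun_prop
  have hDd : ∀ z, 0 < R z → ∃ D' : E →L[ℝ] ℝ, HasFDerivAt D D' z ∧ ‖D'‖ ≤ C2 / N / R z := by
    intro z hz
    obtain ⟨R', h1, h2⟩ := hRd z hz
    have h3 : HasDerivAt (fun s => Real.log (s / s1) / N) (1 / (R z) / N) (R z) := by
      have := (((hasDerivAt_id (R z)).div_const s1).log (by simp; exact ⟨hz.ne', hs1.ne'⟩)).div_const N
      have e : 1 / R z / N = 1 / s1 / (id (R z) / s1) / N := by simp only [id]; field_simp
      rw [e]; exact this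
    have h4 := ((χ.contDiff (n := 1)).differentiable one_ne_zero (Real.log (R z / s1) / N)).hasFDerivAt
    have h6 := h3.comp_hasFDerivAt z h1
    have h5 := HasFDerivAt.comp z h4 h6
    refine ⟨_, h5, (ContinuousLinearMap.opNorm_comp_le _ _).trans ?_⟩
    rw [norm_smul, Real.norm_of_nonneg (by positivity)]
    calc _ ≤ C2 * (1 / R z / N * 1) := by gcongr; exact hχ _
      _ = _ := by field_simp
  have hBd : ∀ z, 0 < R z → ∃ B' : E →L[ℝ] ℝ, HasFDerivAt (fun z => R z ^ (-b)) B' z ∧ ‖B'‖ ≤ b * R z ^ (-b - 1) := by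
    intro z hz
    obtain ⟨R', h1, h2⟩ := hRd z hz
    have h3 := Real.hasDerivAt_rpow_const (x := R z) (p := -b) (Or.inl hz.ne')
    refine ⟨_, h3.comp_hasFDerivAt z h1, ?_⟩
    have : 0 < R z ^ (-b - 1) := by positivity
    rw [norm_smul, norm_mul, norm_neg, Real.norm_of_nonneg hb.le, Real.norm_of_nonneg this.le]
    exact mul_le_of_le_one_right (by positivity) h2
  have hSpos : ∀ z ∈ hdSh U x0 (2 * L) s1 (s1 * Real.exp N ^ 3), 0 < R z := fun z hz => hs1.trans_le hz.2.1
  refine ⟨fun z => R z ^ (-b) * (A z * D z), fun z => A z * D z, ?_, ?_, ?_, ?_, ?_, ?_, ?_⟩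
  · rw [contDiff_iff_contDiffAt]
    intro z
    by_cases hz : R z = 0
    · have : (fun z => R z ^ (-b) * (A z * D z)) =ᶠ[nhds z] fun _ => 0 := by
        have : ∀ᶠ w in nhds z, R w < s1 := hRlip.continuous.continuousAt.eventually_lt continuousAt_const (by rw [hz]; exact hs1)
        filter_upwards [this] with w hw
        have : D w = 0 := by
          by_contra h
          exact absurd (hDsupp w h).1 (not_lt.2 hw.le)
        rw [this]; simp
      exact contDiffAt_const.congr_of_eventuallyEq this
    · have hz' : 0 < R z := lt_of_le_of_ne (hR0 z) (Ne.symm hz)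
      exact ((hRc z hz').rpow_const_of_ne hz).mul (hAc.contDiffAt.mul (hDc z hz'))
  · refine closure_minimal ?_ (hdSh_closed ..)
    intro z hz
    have hz' : R z ^ (-b) * (A z * D z) ≠ 0 := hz
    have h1 := hAsupp z (fun h => hz' (by rw [h]; simp))
    have h2 := hDsupp z (fun h => hz' (by rw [h]; simp))
    exact ⟨h1, h2.1.le, h2.2.le⟩
  · intro z
    exact ⟨mul_nonneg (hA0 z).1 (hD0 z).1, mul_le_one₀ (hA0 z).2 (hD0 z).1 (hD0 z).2⟩
  · rintro z ⟨h1, h2, h3⟩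
    have a1 : A z = 1 := by
      apply η.one_of_mem_closedBall
      rw [mem_closedBall_zero_iff, norm_smul, norm_inv, Real.norm_of_nonneg hL.le, inv_mul_le_iff₀ hL]
      change _ ≤ L * 1
      linarith
    have hRz : 0 < R z := lt_of_lt_of_le (by positivity) h2
    have l1 : N ≤ Real.log (R z / s1) := by
      rw [Real.le_log_iff_exp_le (by positivity), le_div_iff₀ hs1, mul_comm]; exact h2
    have l2 : Real.log (R z / s1) ≤ 2 * N := by
      rw [Real.log_le_iff_le_exp (by positivity), div_le_iff₀ hs1]
      have : Real.exp (2 * N) = Real.exp N ^ 2 := by rw [← Real.exp_nat_mul]; norm_num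
      rw [this, mul_comm]; exact h3
    have a2 : D z = 1 := by
      apply χ.one_of_mem_closedBall
      rw [Metric.mem_closedBall, Real.dist_eq]
      change _ ≤ (1 / 2 : ℝ)
      rw [abs_le]
      have e1 : 1 ≤ Real.log (R z / s1) / N := by rw [le_div_iff₀ hN]; linarith
      have e2 : Real.log (R z / s1) / N ≤ 2 := by rw [div_le_iff₀ hN]; linarith
      constructor <;> linarith
    simp only [a1, a2, mul_one]
  · intro z hz
    exact (hAc.continuous.continuousAt.mul (hDc z (hSpos z hz)).continuousAt).continuousWithinAt
  · intro z hz; rfl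
  · intro z hz
    have hr := hSpos z hz
    obtain ⟨A', a1, a2⟩ := hAd z
    obtain ⟨B', b1, b2⟩ := hBd z hr
    obtain ⟨D', d1, d2⟩ := hDd z hr
    have := b1.mul (a1.mul d1)
    rw [HasFDerivAt.fderiv (f := fun z => R z ^ (-b) * (A z * D z)) this]
    have hB : 0 < R z ^ (-b) := by positivity
    have e : R z ^ (-b - 1) = R z ^ (-b) / R z := by rw [Real.rpow_sub_one hr.ne']
    obtain ⟨A0, A1⟩ := hA0 z
    obtain ⟨D0, D1⟩ := hD0 z
    have n1 : ‖A z • D' + D z • A'‖ ≤ C2 / N / R z + C1 / L := by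
      refine (norm_add_le _ _).trans ?_
      rw [norm_smul, norm_smul, Real.norm_of_nonneg A0, Real.norm_of_nonneg D0]
      refine add_le_add ((mul_le_of_le_one_left (norm_nonneg _) A1).trans d2) ((mul_le_of_le_one_left (norm_nonneg _) D1).trans a2)
    refine (norm_add_le _ _).trans ?_
    rw [norm_smul, norm_smul, Pi.mul_apply, Real.norm_of_nonneg hB.le, Real.norm_of_nonneg (mul_nonneg A0 D0)]
    change _ ≤ R z ^ (-b - 1) * (b * (A z * D z) + (C1 + C2) / N + (C1 + C2) * (R z / L))
    calc _ ≤ R z ^ (-b) * (C2 / N / R z + C1 / L) + (A z * D z) * (b * R z ^ (-b - 1)) := by gcongr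
      _ = R z ^ (-b) / R z * (b * (A z * D z) + C2 / N + C1 * (R z / L)) := by rw [e]; field_simp; ring
      _ ≤ _ := by
        rw [e]
        gcongr <;> linarith
end testfn

section ratio
variable {E : Type*} [NormedAddCommGroup E] [InnerProductSpace ℝ E] [FiniteDimensional ℝ E]

lemma hd_infDist_eq {K : Set E} {U : Submodule ℝ E} {x0 : E} {L s1 s2 : ℝ}
    (hU : ∀ a ∈ K, ∀ b ∈ K, a - b ∈ U) (hx0 : x0 ∈ K) (hin : ∀ u ∈ U, ‖u‖ ≤ L → x0 + u ∈ K)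
    {z : E} (hz : z ∈ hdSh U x0 L s1 s2) : Metric.infDist z K = ‖Uᗮ.starProjection (z - x0)‖ := by
  have e := U.starProjection_add_starProjection_orthogonal (z - x0)
  apply le_antisymm
  · have := Metric.infDist_le_dist_of_mem (x := z) (hin (U.starProjection (z - x0)) (Submodule.starProjection_apply_mem _ _) hz.1)
    refine this.trans (le_of_eq ?_)
    rw [dist_eq_norm]
    congr 1
    rw [← sub_sub]
    nth_rewrite 1 [← e]
    abel
  · rw [Metric.le_infDist ⟨x0, hx0⟩]
    intro y hy
    have h0 : Uᗮ.starProjection (y - x0) = 0 :=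
      (Submodule.starProjection_apply_eq_zero_iff _).2 (by simpa using hU y hy x0 hx0)
    have : z - x0 = (z - y) + (y - x0) := by abel
    rw [this, map_add, h0, add_zero, dist_eq_norm]
    exact Submodule.norm_starProjection_apply_le _ _

variable [MeasurableSpace E] [BorelSpace E]

lemma hd_shell_bound_real (μ : Measure E) [μ.IsAddHaarMeasure] (U : Submodule ℝ E) (x0 : E) {L s1 r : ℝ}
    (hs1 : 0 < s1) (hr : 1 ≤ r) :
    ∫ z in hdSh U x0 (2 * L) s1 (s1 * r ^ 3), ‖Uᗮ.starProjection (z - x0)‖ ^ (-(Module.finrank ℝ Uᗮ : ℝ)) ∂μ ≤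
      (3 * 2 ^ Module.finrank ℝ U) * ∫ z in hdSh U x0 L (s1 * r) (s1 * r ^ 2),
        ‖Uᗮ.starProjection (z - x0)‖ ^ (-(Module.finrank ℝ Uᗮ : ℝ)) ∂μ := by
  have hi : ∀ L' a b : ℝ, 0 < a → IntegrableOn (fun z => ‖Uᗮ.starProjection (z - x0)‖ ^ (-(Module.finrank ℝ Uᗮ : ℝ))) (hdSh U x0 L' a b) μ := by
    intro L' a b ha
    refine ContinuousOn.integrableOn_compact (hdSh_compact ..) ?_
    refine ContinuousOn.rpow_const (by fun_prop) ?_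
    intro z hz
    exact Or.inl (ha.trans_le hz.2.1).ne'
  have h0 : ∀ s : Set E, 0 ≤ᵐ[μ.restrict s] (fun z => ‖Uᗮ.starProjection (z - x0)‖ ^ (-(Module.finrank ℝ Uᗮ : ℝ))) :=
    fun s => Eventually.of_forall (fun z => by positivity)
  have hr0 : 0 < r := by linarith
  have h := hd_shell_bound μ U x0 (L := L) hs1 hr
  rw [← ofReal_integral_eq_lintegral_ofReal (hi _ _ _ hs1) (h0 _),
    ← ofReal_integral_eq_lintegral_ofReal (hi _ _ _ (by positivity)) (h0 _), ← ENNReal.ofReal_mul (by positivity)] at h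
  rwa [ENNReal.ofReal_le_ofReal_iff] at h
  exact mul_nonneg (by positivity) (integral_nonneg fun z => by positivity)

lemma hd_ratio (μ : Measure E) [μ.IsAddHaarMeasure] {K : Set E} {U : Submodule ℝ E} {x0 : E}
    {L s1 N C b p m ε ε' η0 B : ℝ} {c : ℝ → ℝ} {φ f : E → ℝ} (hN : 0 < N) (hs1 : 0 < s1) (hL : 0 < L)
    (hC : 0 < C) (hb : 0 < b) (hp : 1 < p) (hbp : (b + 1) * p = m + Module.finrank ℝ Uᗮ)
    (hKm : MeasurableSet Kᶜ) (hK : ∀ z ∈ hdSh U x0 (2 * L) s1 (s1 * Real.exp N ^ 3), Metric.infDist z K = ‖Uᗮ.starProjection (z - x0)‖)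
    (hcc : ContinuousOn c (Ioi 0))
    (hε : 0 ≤ 1 + ε) (hε1 : ε < 1) (hε' : 0 ≤ ε')
    (hc : ∀ s, s1 ≤ s → s ≤ s1 * Real.exp N ^ 3 → (1 - ε) * s ^ m ≤ c s ∧ c s ≤ (1 + ε) * s ^ m)
    (hη : C / N + C * (s1 * Real.exp N ^ 3 / L) ≤ η0)
    (hη0 : ∀ t, 0 ≤ t → t ≤ 1 → (b * t + η0) ^ p ≤ b ^ p * t ^ p + ε')
    (hB : (1 + ε) * (b ^ p + ε' * (3 * 2 ^ Module.finrank ℝ U)) ≤ B * (1 - ε)) (hB0 : 0 ≤ B)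
    (h1 : ContDiff ℝ 1 φ) (h2 : tsupport φ ⊆ hdSh U x0 (2 * L) s1 (s1 * Real.exp N ^ 3))
    (h3 : ∀ z, 0 ≤ f z ∧ f z ≤ 1) (h4 : ∀ z ∈ hdSh U x0 L (s1 * Real.exp N) (s1 * Real.exp N ^ 2), f z = 1)
    (h5 : ContinuousOn f (hdSh U x0 (2 * L) s1 (s1 * Real.exp N ^ 3)))
    (h6 : ∀ z ∈ hdSh U x0 (2 * L) s1 (s1 * Real.exp N ^ 3), φ z = ‖Uᗮ.starProjection (z - x0)‖ ^ (-b) * f z)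
    (h7 : ∀ z ∈ hdSh U x0 (2 * L) s1 (s1 * Real.exp N ^ 3), ‖fderiv ℝ φ z‖ ≤
        ‖Uᗮ.starProjection (z - x0)‖ ^ (-b - 1) * (b * f z + C / N + C * (‖Uᗮ.starProjection (z - x0)‖ / L))) :
    tsupport φ ⊆ Kᶜ ∧
    (∫ x in Kᶜ, c (Metric.infDist x K) * ‖fderiv ℝ φ x‖ ^ p ∂μ) ≤
     B * (∫ x in Kᶜ, c (Metric.infDist x K) * Metric.infDist x K ^ (-p) * |φ x| ^ p ∂μ) := by
  have hp0 : 0 < p := by linarith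
  set S := hdSh U x0 (2 * L) s1 (s1 * Real.exp N ^ 3) with hS
  set R : E → ℝ := fun z => ‖Uᗮ.starProjection (z - x0)‖ with hR
  have hRS : ∀ z ∈ S, 0 < R z := fun z hz => hs1.trans_le hz.2.1
  have hSK : S ⊆ Kᶜ := by
    intro z hz hzK
    have := hK z hz
    rw [Metric.infDist_zero_of_mem hzK] at this
    exact absurd this (hRS z hz).ne
  have hSm : MeasurableSet S := (hdSh_closed ..).measurableSet
  have hSc : IsCompact S := hdSh_compact ..
  have hRc : Continuous R := by fun_prop
  have φ0 : ∀ z, z ∉ S → φ z = 0 := fun z hz => image_eq_zero_of_notMem_tsupport (fun h => hz (h2 h))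
  have dφ0 : ∀ z, z ∉ S → fderiv ℝ φ z = 0 := fun z hz => by
    by_contra h
    exact hz (h2 (support_fderiv_subset ℝ h))
  have hRn : ContinuousOn (fun z => R z ^ (-(Module.finrank ℝ Uᗮ : ℝ))) S :=
    ContinuousOn.rpow_const hRc.continuousOn (fun z hz => Or.inl (hRS z hz).ne')
  have hfp : ContinuousOn (fun z => f z ^ p) S :=
    ContinuousOn.rpow_const h5 (fun z hz => Or.inr hp0.le)
  refine ⟨h2.trans hSK, ?_⟩
  have eN : ∫ x in Kᶜ, c (Metric.infDist x K) * ‖fderiv ℝ φ x‖ ^ p ∂μ =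
      ∫ x in S, c (Metric.infDist x K) * ‖fderiv ℝ φ x‖ ^ p ∂μ := by
    refine setIntegral_eq_of_subset_of_forall_diff_eq_zero hKm hSK ?_
    intro z hz
    rw [dφ0 z hz.2, norm_zero, Real.zero_rpow hp0.ne', mul_zero]
  have eD : ∫ x in Kᶜ, c (Metric.infDist x K) * Metric.infDist x K ^ (-p) * |φ x| ^ p ∂μ =
      ∫ x in S, c (Metric.infDist x K) * Metric.infDist x K ^ (-p) * |φ x| ^ p ∂μ := by
    refine setIntegral_eq_of_subset_of_forall_diff_eq_zero hKm hSK ?_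
    intro z hz
    rw [φ0 z hz.2, abs_zero, Real.zero_rpow hp0.ne', mul_zero]
  set n : ℝ := (Module.finrank ℝ Uᗮ : ℝ) with hn
  have i1 : IntegrableOn (fun z => R z ^ (-n) * f z ^ p) S μ := (hRn.mul hfp).integrableOn_compact hSc
  have i2 : IntegrableOn (fun z => R z ^ (-n)) S μ := hRn.integrableOn_compact hSc
  have hexp : ∀ z ∈ S, R z ^ m * (R z ^ (-b - 1)) ^ p = R z ^ (-n) := by
    intro z hz
    rw [← Real.rpow_mul (hRS z hz).le, ← Real.rpow_add (hRS z hz)]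
    congr 1
    linarith
  have hexp2 : ∀ z ∈ S, R z ^ m * R z ^ (-p) * (R z ^ (-b)) ^ p = R z ^ (-n) := by
    intro z hz
    rw [← Real.rpow_mul (hRS z hz).le, ← Real.rpow_add (hRS z hz), ← Real.rpow_add (hRS z hz)]
    congr 1
    linarith
  -- numerator
  have hnum : ∫ x in S, c (Metric.infDist x K) * ‖fderiv ℝ φ x‖ ^ p ∂μ ≤
      ∫ z in S, (1 + ε) * (b ^ p * (R z ^ (-n) * f z ^ p) + ε' * R z ^ (-n)) ∂μ := by
    refine integral_mono_of_nonneg ?_ (((i1.const_mul _).add (i2.const_mul _)).const_mul _) ?_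
    · filter_upwards [ae_restrict_mem hSm] with z hz
      rw [Pi.zero_apply, hK z hz]
      have := (hc (R z) hz.2.1 hz.2.2).1
      have h8 : 0 ≤ c (R z) := le_trans (mul_nonneg (by linarith) (Real.rpow_nonneg (hRS z hz).le _)) this
      exact mul_nonneg h8 (by positivity)
    · filter_upwards [ae_restrict_mem hSm] with z hz
      rw [hK z hz]
      have hz' := hRS z hz
      have g1 := (hc (R z) hz.2.1 hz.2.2).2
      have g2 : ‖fderiv ℝ φ z‖ ^ p ≤ (R z ^ (-b - 1)) ^ p * (b ^ p * f z ^ p + ε') := by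
        calc _ ≤ (R z ^ (-b - 1) * (b * f z + η0)) ^ p := by
              refine Real.rpow_le_rpow (norm_nonneg _) ((h7 z hz).trans ?_) hp0.le
              refine mul_le_mul_of_nonneg_left ?_ (by positivity)
              have : R z / L ≤ s1 * Real.exp N ^ 3 / L := by
                gcongr; exact hz.2.2
              have : C * (R z / L) ≤ C * (s1 * Real.exp N ^ 3 / L) := by gcongr
              change b * f z + C / N + C * (R z / L) ≤ _
              linarith
          _ = (R z ^ (-b - 1)) ^ p * (b * f z + η0) ^ p := by
              refine Real.mul_rpow (by positivity) ?_
              have := (h3 z).1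
              have : 0 ≤ η0 := le_trans (by positivity) hη
              positivity
          _ ≤ _ := by
              refine mul_le_mul_of_nonneg_left (hη0 _ (h3 z).1 (h3 z).2) (by positivity)
      calc c (R z) * ‖fderiv ℝ φ z‖ ^ p ≤ ((1 + ε) * R z ^ m) * ((R z ^ (-b - 1)) ^ p * (b ^ p * f z ^ p + ε')) :=
            mul_le_mul g1 g2 (by positivity) (by positivity)
        _ = (1 + ε) * (R z ^ m * (R z ^ (-b - 1)) ^ p) * (b ^ p * f z ^ p + ε') := by ring
        _ = _ := by rw [hexp z hz]; ring
  have hden : ∫ z in S, (1 - ε) * (R z ^ (-n) * f z ^ p) ∂μ ≤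
      ∫ x in S, c (Metric.infDist x K) * Metric.infDist x K ^ (-p) * |φ x| ^ p ∂μ := by
    refine setIntegral_mono_on (i1.const_mul _) ?_ hSm ?_
    · refine ContinuousOn.integrableOn_compact hSc ?_
      have hinf : ContinuousOn (fun z => Metric.infDist z K) S := (Metric.continuous_infDist_pt K).continuousOn
      have hpos : ∀ z ∈ S, 0 < Metric.infDist z K := fun z hz => by rw [hK z hz]; exact hRS z hz
      refine ((hcc.comp hinf hpos).mul (hinf.rpow_const fun z hz => Or.inl (hpos z hz).ne')).mul ?_
      exact ContinuousOn.rpow_const (h1.continuous.abs.continuousOn) (fun z hz => Or.inr hp0.le)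
    · intro z hz
      rw [hK z hz, h6 z hz]
      change _ ≤ c (R z) * R z ^ (-p) * |R z ^ (-b) * f z| ^ p
      have hz' := hRS z hz
      have hf := (h3 z).1
      rw [abs_of_nonneg (by positivity), Real.mul_rpow (by positivity) hf, ← hexp2 z hz]
      have g1 := (hc (R z) hz.2.1 hz.2.2).1
      calc _ = ((1 - ε) * R z ^ m) * (R z ^ (-p) * ((R z ^ (-b)) ^ p * f z ^ p)) := by ring
        _ ≤ c (R z) * (R z ^ (-p) * ((R z ^ (-b)) ^ p * f z ^ p)) := by gcongr
        _ = _ := by ring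
  have hI2 : ∫ z in S, R z ^ (-n) ∂μ ≤ (3 * 2 ^ Module.finrank ℝ U) * ∫ z in S, R z ^ (-n) * f z ^ p ∂μ := by
    refine (hd_shell_bound_real μ U x0 hs1 (Real.one_le_exp hN.le)).trans ?_
    refine mul_le_mul_of_nonneg_left ?_ (by positivity)
    have hS' : hdSh U x0 L (s1 * Real.exp N) (s1 * Real.exp N ^ 2) ⊆ S := by
      rintro z ⟨q1, q2, q3⟩
      have e1 := Real.one_le_exp hN.le
      refine ⟨by linarith, ?_, q3.trans ?_⟩
      · refine le_trans ?_ q2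
        exact le_mul_of_one_le_right hs1.le e1
      · gcongr
        norm_num
    calc _ = ∫ z in hdSh U x0 L (s1 * Real.exp N) (s1 * Real.exp N ^ 2), R z ^ (-n) * f z ^ p ∂μ := by
          refine setIntegral_congr_fun (hdSh_closed ..).measurableSet ?_
          intro z hz
          simp only [h4 z hz, Real.one_rpow, mul_one]; rfl
      _ ≤ _ := by
          refine setIntegral_mono_set i1 ?_ (LE.le.eventuallyLE hS')
          exact Eventually.of_forall fun z => mul_nonneg (Real.rpow_nonneg (norm_nonneg _) _) (Real.rpow_nonneg (h3 z).1 _)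
  rw [eN, eD]
  set D0 := ∫ z in S, R z ^ (-n) * f z ^ p ∂μ with hD0
  have hD0' : 0 ≤ D0 := integral_nonneg fun z => mul_nonneg (Real.rpow_nonneg (norm_nonneg _) _) (Real.rpow_nonneg (h3 z).1 _)
  rw [integral_const_mul, integral_add (i1.const_mul _) (i2.const_mul _), integral_const_mul, integral_const_mul] at hnum
  rw [integral_const_mul] at hden
  calc _ ≤ _ := hnum
    _ ≤ (1 + ε) * (b ^ p * D0 + ε' * ((3 * 2 ^ Module.finrank ℝ U) * D0)) := by gcongr
    _ = ((1 + ε) * (b ^ p + ε' * (3 * 2 ^ Module.finrank ℝ U))) * D0 := by ring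
    _ ≤ (B * (1 - ε)) * D0 := by gcongr
    _ = B * ((1 - ε) * D0) := by ring
    _ ≤ _ := by gcongr
end ratio

section upper
variable {E : Type*} [NormedAddCommGroup E] [InnerProductSpace ℝ E] [FiniteDimensional ℝ E]

lemma hd_unif {b p e : ℝ} (hb : 0 < b) (hp : 1 < p) (he : 0 < e) :
    ∃ η0 : ℝ, 0 < η0 ∧ ∀ t, 0 ≤ t → t ≤ 1 → (b * t + η0) ^ p ≤ b ^ p * t ^ p + e := by
  have hc : ContinuousOn (fun x : ℝ => x ^ p) (Icc 0 (b + 1)) :=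
    continuousOn_id.rpow_const (fun x _ => Or.inr (by linarith))
  have hu := isCompact_Icc.uniformContinuousOn_of_continuous hc
  rw [Metric.uniformContinuousOn_iff] at hu
  obtain ⟨r, hr, h⟩ := hu e he
  refine ⟨min (r / 2) 1, by positivity, ?_⟩
  intro t ht0 ht1
  have m1 : min (r / 2) 1 ≤ r / 2 := min_le_left _ _
  have m2 : min (r / 2) 1 ≤ 1 := min_le_right _ _
  have m3 : 0 < min (r / 2) 1 := by positivity
  have hbt : 0 ≤ b * t := by positivity
  have hbt' : b * t ≤ b := mul_le_of_le_one_right hb.le ht1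
  have := h (b * t + min (r / 2) 1) ⟨by linarith, by linarith⟩ (b * t) ⟨hbt, by linarith⟩ (by
    rw [Real.dist_eq, add_sub_cancel_left, abs_of_pos m3]; linarith)
  rw [Real.dist_eq, abs_lt] at this
  rw [← Real.mul_rpow hb.le ht0]
  linarith [this.2]

variable [MeasurableSpace E] [BorelSpace E]

lemma hd_upper (μ : Measure E) [μ.IsAddHaarMeasure] {K : Set E} {U : Submodule ℝ E}
    {b p m B : ℝ} {c : ℝ → ℝ} (hKcl : IsClosed K) (hU : ∀ a ∈ K, ∀ b ∈ K, a - b ∈ U)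
    (hn : 1 ≤ Module.finrank ℝ Uᗮ)
    (hb : 0 < b) (hp : 1 < p) (hbp : (b + 1) * p = m + Module.finrank ℝ Uᗮ)
    (hcc : ContinuousOn c (Ioi 0))
    (hfam : ∀ ε N : ℝ, 0 < ε → ε < 1 → 0 < N → ∃ x0 ∈ K, ∃ s1 L : ℝ, 0 < s1 ∧ 0 < L ∧
      (∀ u ∈ U, ‖u‖ ≤ 2 * L → x0 + u ∈ K) ∧ s1 * Real.exp N ^ 3 ≤ ε * L ∧
      ∀ s, s1 ≤ s → s ≤ s1 * Real.exp N ^ 3 → (1 - ε) * s ^ m ≤ c s ∧ c s ≤ (1 + ε) * s ^ m)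
    (hB : b ^ p < B) :
    ∃ φ : E → ℝ, ContDiff ℝ 1 φ ∧ HasCompactSupport φ ∧ tsupport φ ⊆ Kᶜ ∧ φ ≠ 0 ∧
    (∫ x in Kᶜ, c (Metric.infDist x K) * ‖fderiv ℝ φ x‖ ^ p ∂μ) ≤
     B * (∫ x in Kᶜ, c (Metric.infDist x K) * Metric.infDist x K ^ (-p) * |φ x| ^ p ∂μ) := by
  obtain ⟨C, hC, htest⟩ := hd_test U
  set Q : ℝ := 3 * 2 ^ Module.finrank ℝ U with hQ
  have hQ0 : 0 < Q := by positivity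
  have hbp0 : 0 < b ^ p := by positivity
  set e : ℝ := (B - b ^ p) / 2 / Q with he
  have he0 : 0 < e := by
    have : 0 < B - b ^ p := by linarith
    positivity
  have heQ : b ^ p + e * Q = (B + b ^ p) / 2 := by
    rw [he, div_mul_cancel₀ _ hQ0.ne']; ring
  obtain ⟨η0, hη0, hη⟩ := hd_unif hb hp he0
  set ε1 : ℝ := (B - b ^ p) / (4 * B) with hε1
  have hBpos : 0 < B := by linarith
  have hε1pos : 0 < ε1 := by
    have : 0 < B - b ^ p := by linarith
    positivity
  set ε := min (min ε1 (1 / 2)) (η0 / (2 * C)) with hε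
  have ε0 : 0 < ε := by positivity
  have εa : ε ≤ ε1 := (min_le_left _ _).trans (min_le_left _ _)
  have εb : ε ≤ 1 / 2 := (min_le_left _ _).trans (min_le_right _ _)
  have εc : ε ≤ η0 / (2 * C) := min_le_right _ _
  set N := 2 * C / η0 with hN
  have hN0 : 0 < N := by positivity
  obtain ⟨x0, hx0, s1, L, hs1, hL, hin, hsL, hcb⟩ := hfam ε N ε0 (by linarith) hN0
  obtain ⟨φ, f, h1, h2, h3, h4, h5, h6, h7⟩ := htest x0 b N s1 L hb hN0 hs1 hL
  have hη' : C / N + C * (s1 * Real.exp N ^ 3 / L) ≤ η0 := by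
    have a1 : C / N = η0 / 2 := by rw [hN]; field_simp
    have a2 : s1 * Real.exp N ^ 3 / L ≤ ε := by rw [div_le_iff₀ hL]; exact hsL
    have a3 : C * (s1 * Real.exp N ^ 3 / L) ≤ C * (η0 / (2 * C)) := mul_le_mul_of_nonneg_left (a2.trans εc) hC.le
    have a4 : C * (η0 / (2 * C)) = η0 / 2 := by field_simp
    linarith
  have hBB : (1 + ε) * (b ^ p + e * Q) ≤ B * (1 - ε) := by
    rw [heQ]
    have : ε * (4 * B) ≤ B - b ^ p := by
      rw [hε1, le_div_iff₀ (by positivity)] at εa; exact εa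
    nlinarith
  obtain ⟨r1, r2⟩ := hd_ratio μ (K := K) hN0 hs1 hL hC hb hp hbp hKcl.measurableSet.compl
    (fun z hz => hd_infDist_eq hU hx0 hin hz) hcc (by linarith) (by linarith) he0.le hcb hη' hη hBB hBpos.le h1 h2 h3 h4 h5 h6 h7
  refine ⟨φ, h1, (hdSh_compact ..).of_isClosed_subset (isClosed_tsupport _) h2, r1, ?_, r2⟩
  intro h0
  have : Nontrivial Uᗮ := Module.nontrivial_of_finrank_pos (R := ℝ) (by omega)
  obtain ⟨v, hv⟩ := exists_norm_eq Uᗮ (c := s1 * Real.exp N) (by positivity)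
  have y1 : U.starProjection (v : E) = 0 := (Submodule.starProjection_apply_eq_zero_iff _).2 v.2
  have y2 : Uᗮ.starProjection (v : E) = v := Submodule.starProjection_eq_self_iff.2 v.2
  have hv' : ‖(v : E)‖ = s1 * Real.exp N := hv
  have e1 := Real.one_le_exp hN0.le
  have z1 : x0 + (v : E) ∈ hdSh U x0 L (s1 * Real.exp N) (s1 * Real.exp N ^ 2) := by
    rw [hdSh, mem_ofPred_eq, add_sub_cancel_left, y1, y2, norm_zero, hv']
    refine ⟨hL.le, le_rfl, ?_⟩
    gcongr
    nlinarith
  have z2 : x0 + (v : E) ∈ hdSh U x0 (2 * L) s1 (s1 * Real.exp N ^ 3) := by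
    rw [hdSh, mem_ofPred_eq, add_sub_cancel_left, y1, y2, norm_zero, hv']
    refine ⟨by positivity, ?_, ?_⟩
    · exact le_mul_of_one_le_right hs1.le e1
    · gcongr
      exact le_self_pow₀ e1 (by norm_num)
  have := h6 _ z2
  rw [h0, h4 _ z1, add_sub_cancel_left, y2, hv', mul_one, Pi.zero_apply] at this
  have : 0 < (s1 * Real.exp N) ^ (-b) := by positivity
  linarith
end upper

/-- weight -/
def hdc (δ δ' : ℝ) (s : ℝ) : ℝ := s ^ δ * (1 + s) ^ (δ' - δ)

lemma hdc_cont (δ δ' : ℝ) : ContinuousOn (hdc δ δ') (Ioi 0) := by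
  intro s hs
  have hs' : (0:ℝ) < s := hs
  refine ContinuousAt.continuousWithinAt ?_
  unfold hdc
  refine (continuousAt_id.rpow_const (Or.inl hs'.ne')).mul (ContinuousAt.rpow_const (by fun_prop) (Or.inl (by positivity)))

lemma hdc_meas (δ δ' : ℝ) : Measurable (hdc δ δ') := by
  unfold hdc
  fun_prop

lemma hdc_nonneg (δ δ' : ℝ) {s : ℝ} (hs : 0 ≤ s) : 0 ≤ hdc δ δ' s := by
  unfold hdc; positivity

lemma hdc_growth (δ δ' : ℝ) {s t : ℝ} (hs : 0 < s) (ht : 1 ≤ t) :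
    hdc δ δ' s ≤ t ^ (-(min δ δ')) * hdc δ δ' (t * s) := by
  have ht0 : 0 < t := by linarith
  unfold hdc
  rw [Real.mul_rpow ht0.le hs.le]
  rcases le_total δ δ' with h | h
  · rw [min_eq_left h]
    calc s ^ δ * (1 + s) ^ (δ' - δ) ≤ s ^ δ * (1 + t * s) ^ (δ' - δ) := by
          gcongr
          exact le_mul_of_one_le_left hs.le ht
      _ = (t ^ (-δ) * t ^ δ) * (s ^ δ * (1 + t * s) ^ (δ' - δ)) := by
          rw [← Real.rpow_add ht0]; simp
      _ = _ := by ring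
  · rw [min_eq_right h]
    calc s ^ δ * (1 + s) ^ (δ' - δ) = (t ^ (-δ') * t ^ δ * t ^ (δ' - δ)) * (s ^ δ * (1 + s) ^ (δ' - δ)) := by
          rw [← Real.rpow_add ht0, ← Real.rpow_add ht0]; simp
      _ = t ^ (-δ') * (t ^ δ * s ^ δ * (t * (1 + s)) ^ (δ' - δ)) := by
          rw [Real.mul_rpow ht0.le (by positivity)]; ring
      _ ≤ t ^ (-δ') * (t ^ δ * s ^ δ * (1 + t * s) ^ (δ' - δ)) := by
          refine mul_le_mul_of_nonneg_left (mul_le_mul_of_nonneg_left ?_ (by positivity)) (by positivity)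
          exact Real.rpow_le_rpow_of_nonpos (by positivity) (by nlinarith) (by linarith)

lemma hdc_small (δ δ' : ℝ) {ε : ℝ} (hε : 0 < ε) : ∃ r : ℝ, 0 < r ∧ ∀ s, 0 < s → s < r →
    (1 - ε) * s ^ δ ≤ hdc δ δ' s ∧ hdc δ δ' s ≤ (1 + ε) * s ^ δ := by
  have hc : ContinuousAt (fun s : ℝ => (1 + s) ^ (δ' - δ)) 0 :=
    ContinuousAt.rpow_const (by fun_prop) (Or.inl (by norm_num))
  rw [Metric.continuousAt_iff] at hc
  obtain ⟨r, hr, h⟩ := hc ε hε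
  refine ⟨r, hr, fun s hs hsr => ?_⟩
  have := h (x := s) (by rw [Real.dist_eq, sub_zero, abs_of_pos hs]; exact hsr)
  rw [Real.dist_eq, abs_lt, add_zero, Real.one_rpow] at this
  have hp : 0 < s ^ δ := by positivity
  unfold hdc
  constructor <;> nlinarith [this.1, this.2]

lemma hdc_large (δ δ' : ℝ) {ε : ℝ} (hε : 0 < ε) : ∃ r : ℝ, 0 < r ∧ ∀ s, r < s →
    (1 - ε) * s ^ δ' ≤ hdc δ δ' s ∧ hdc δ δ' s ≤ (1 + ε) * s ^ δ' := by
  obtain ⟨r, hr, h⟩ := hdc_small 0 (δ' - δ) hε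
  refine ⟨r⁻¹, by positivity, fun s hs => ?_⟩
  have hs0 : 0 < s := lt_trans (by positivity) hs
  have h1 := h s⁻¹ (by positivity) (inv_lt_of_inv_lt₀ hr hs)
  have e : hdc δ δ' s = s ^ δ' * hdc 0 (δ' - δ) s⁻¹ := by
    unfold hdc
    rw [Real.rpow_zero, one_mul, sub_zero]
    have : 1 + s = s * (1 + s⁻¹) := by field_simp; ring
    rw [this, Real.mul_rpow hs0.le (by positivity), ← mul_assoc, ← Real.rpow_add hs0]
    ring_nf
  rw [Real.rpow_zero] at h1
  rw [e]
  have hp : 0 < s ^ δ' := by positivity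
  constructor <;> nlinarith [h1.1, h1.2]

section geo
variable {E : Type*} [NormedAddCommGroup E] [InnerProductSpace ℝ E] [FiniteDimensional ℝ E]

lemma hd_relint {K : Set E} (hne : K.Nonempty) (hc : Convex ℝ K) : ∃ x0 ∈ K, ∃ r0 : ℝ, 0 < r0 ∧
    ∀ u ∈ (affineSpan ℝ K).direction, ‖u‖ < r0 → x0 + u ∈ K := by
  obtain ⟨x, hx⟩ := hne.intrinsicInterior hc
  obtain ⟨y, hy, rfl⟩ := hx
  rw [mem_interior_iff_mem_nhds, Metric.mem_nhds_iff] at hy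
  obtain ⟨r0, hr0, hb⟩ := hy
  refine ⟨y, hb (Metric.mem_ball_self hr0), r0, hr0, ?_⟩
  intro u hu hur
  have hm : (u : E) +ᵥ (y : E) ∈ affineSpan ℝ K := AffineSubspace.vadd_mem_of_mem_direction hu y.2
  have : (⟨u +ᵥ (y : E), hm⟩ : affineSpan ℝ K) ∈ Metric.ball y r0 := by
    rw [Metric.mem_ball, Subtype.dist_eq]
    simpa [dist_eq_norm] using hur
  have := hb this
  rw [add_comm]
  exact this
end geo

section lower
variable {E : Type*} [NormedAddCommGroup E] [InnerProductSpace ℝ E] [FiniteDimensional ℝ E]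
  [MeasurableSpace E] [BorelSpace E]

lemma hd_lower (μ : Measure E) [μ.IsAddHaarMeasure] {K : Set E} {U : Submodule ℝ E}
    {b p δ δ' : ℝ} (hne : K.Nonempty) (hKcl : IsClosed K) (hKc : Convex ℝ K) (hU : ∀ a ∈ K, ∀ b ∈ K, a - b ∈ U)
    (hb : 0 < b) (hp : 1 < p) (hbp : (b + 1) * p = min δ δ' + Module.finrank ℝ Uᗮ)
    {φ : E → ℝ} (h1 : ContDiff ℝ 1 φ) (h2 : HasCompactSupport φ) (h3 : tsupport φ ⊆ Kᶜ) (h4 : φ ≠ 0) :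
    0 < (∫ x in Kᶜ, hdc δ δ' (Metric.infDist x K) * Metric.infDist x K ^ (-p) * |φ x| ^ p ∂μ) ∧
    b ^ p * (∫ x in Kᶜ, hdc δ δ' (Metric.infDist x K) * Metric.infDist x K ^ (-p) * |φ x| ^ p ∂μ) ≤
    (∫ x in Kᶜ, hdc δ δ' (Metric.infDist x K) * ‖fderiv ℝ φ x‖ ^ p ∂μ) := by
  have hp0 : 0 < p := by linarith
  have hset : {z | 0 < Metric.infDist z K} = Kᶜ := by
    ext z
    exact (hKcl.notMem_iff_infDist_pos hne).symm
  have hpos : ∀ z ∈ Kᶜ, 0 < Metric.infDist z K := fun z hz => (hKcl.notMem_iff_infDist_pos hne).1 hz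
  have hinf : ContinuousOn (fun z => Metric.infDist z K) Kᶜ := (Metric.continuous_infDist_pt K).continuousOn
  have hcc : ContinuousOn (fun z => hdc δ δ' (Metric.infDist z K)) Kᶜ := (hdc_cont δ δ').comp hinf hpos
  set g : E → ℝ := fun x => hdc δ δ' (Metric.infDist x K) * ‖fderiv ℝ φ x‖ ^ p with hg
  set h : E → ℝ := fun x => hdc δ δ' (Metric.infDist x K) * Metric.infDist x K ^ (-p) * |φ x| ^ p with hh
  have hgc : ContinuousOn g Kᶜ := by
    refine hcc.mul (ContinuousOn.rpow_const ?_ (fun z hz => Or.inr hp0.le))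
    exact (h1.continuous_fderiv one_ne_zero).norm.continuousOn
  have hhc : ContinuousOn h Kᶜ := by
    refine (hcc.mul (hinf.rpow_const fun z hz => Or.inl (hpos z hz).ne')).mul ?_
    exact ContinuousOn.rpow_const (h1.continuous.abs.continuousOn) (fun z hz => Or.inr hp0.le)
  have hg0 : ∀ z, 0 ≤ g z := fun z => mul_nonneg (hdc_nonneg _ _ Metric.infDist_nonneg) (by positivity)
  have hh0 : ∀ z, 0 ≤ h z := fun z => mul_nonneg (mul_nonneg (hdc_nonneg _ _ Metric.infDist_nonneg)
    (Real.rpow_nonneg Metric.infDist_nonneg _)) (by positivity)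
  have hgs : ∀ z, z ∉ tsupport φ → g z = 0 := by
    intro z hz
    have : fderiv ℝ φ z = 0 := by
      by_contra h
      exact hz (support_fderiv_subset ℝ h)
    simp only [hg, this, norm_zero, Real.zero_rpow hp0.ne', mul_zero]
  have hhs : ∀ z, z ∉ tsupport φ → h z = 0 := by
    intro z hz
    simp only [hh, image_eq_zero_of_notMem_tsupport hz, abs_zero, Real.zero_rpow hp0.ne', mul_zero]
  have hgi : Integrable g μ := by
    refine (integrableOn_iff_integrable_of_support_subset (s := tsupport φ) ?_).1
      ((hgc.mono h3).integrableOn_compact h2)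
    intro z hz; by_contra h'; exact hz (hgs z h')
  have hhi : Integrable h μ := by
    refine (integrableOn_iff_integrable_of_support_subset (s := tsupport φ) ?_).1
      ((hhc.mono h3).integrableOn_compact h2)
    intro z hz; by_contra h'; exact hz (hhs z h')
  have eg : ∫ x in Kᶜ, g x ∂μ = ∫ x, g x ∂μ :=
    setIntegral_eq_integral_of_forall_compl_eq_zero (fun z hz => hgs z (fun h => hz (h3 h)))
  have eh : ∫ x in Kᶜ, h x ∂μ = ∫ x, h x ∂μ :=
    setIntegral_eq_integral_of_forall_compl_eq_zero (fun z hz => hhs z (fun h => hz (h3 h)))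
  constructor
  · rw [eh, integral_pos_iff_support_of_nonneg hh0 hhi]
    have hsub : Function.support φ ⊆ Function.support h := by
      intro z hz
      have hz' : φ z ≠ 0 := hz
      have := hpos z (h3 (subset_tsupport _ hz))
      have : 0 < h z := by
        simp only [hh, hdc]
        have := abs_pos.2 hz'
        positivity
      exact this.ne'
    refine lt_of_lt_of_le ?_ (measure_mono hsub)
    refine IsOpen.measure_pos μ (h1.continuous.isOpen_support) ?_
    rw [Function.support_nonempty_iff]; exact h4
  · obtain ⟨P, hP⟩ := hd_exists_proj hne hKcl hKc
    have hPr : HdProj K P := ⟨fun z => (hP z).1, fun z => (hP z).2.1, fun z => (hP z).2.2⟩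
    have key := hPr.hardy μ hU hp (by linarith : 1 < b + 1) hbp (hdc_meas δ δ') (fun s hs => hdc_nonneg δ δ' hs)
      (fun s t hs ht => hdc_growth δ δ' hs ht) h1 h2
    rw [hset, add_sub_cancel_right, ← ofReal_integral_eq_lintegral_ofReal hhi.integrableOn (Eventually.of_forall hh0),
      ← ofReal_integral_eq_lintegral_ofReal hgi (Eventually.of_forall hg0), ← ENNReal.ofReal_mul (by positivity),
      ENNReal.ofReal_le_ofReal_iff (mul_nonneg (by positivity) (integral_nonneg hg0)),
      Real.inv_rpow hb.le, le_inv_mul_iff₀ (by positivity)] at key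
    rw [eg]; exact key
end lower

lemma hd_family {E : Type*} [NormedAddCommGroup E] [InnerProductSpace ℝ E] [FiniteDimensional ℝ E]
    [MeasurableSpace E] [BorelSpace E] {K : Set E} (hcl : IsClosed K) (hc : Convex ℝ K) {k : ℕ} (hk1 : 1 ≤ k)
    (hk : Module.finrank ℝ (affineSpan ℝ K).direction = k)
    (hU : ∀ a ∈ K, ∀ b ∈ K, a - b ∈ (affineSpan ℝ K).direction)
    (hne : K.Nonempty)
    (hkinf : Filter.liminf
        (fun r : ℝ =>
          Real.log ((μH[(k : ℝ)] (K ∩ Metric.ball 0 r)).toReal) / Real.log r)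
        Filter.atTop = (k : ℝ)) (δ δ' ε N : ℝ) (hε : 0 < ε) :
    ∃ x0 ∈ K, ∃ s1 L : ℝ, 0 < s1 ∧ 0 < L ∧
      (∀ u ∈ (affineSpan ℝ K).direction, ‖u‖ ≤ 2 * L → x0 + u ∈ K) ∧ s1 * Real.exp N ^ 3 ≤ ε * L ∧
      ∀ s, s1 ≤ s → s ≤ s1 * Real.exp N ^ 3 → (1 - ε) * s ^ (min δ δ') ≤ hdc δ δ' s ∧
        hdc δ δ' s ≤ (1 + ε) * s ^ (min δ δ') := by
  rcases le_total δ δ' with h | h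
  · rw [min_eq_left h]
    obtain ⟨x0, hx0, r0, hr0, hin⟩ := hd_relint hne hc
    obtain ⟨r, hr, hcs⟩ := hdc_small δ δ' hε
    refine ⟨x0, hx0, min (r / 2) (ε * (r0 / 3)) / Real.exp N ^ 3, r0 / 3, by positivity, by positivity,
      fun u hu hur => hin u hu (by linarith), ?_, ?_⟩
    · rw [div_mul_cancel₀ _ (by positivity)]; exact min_le_right _ _
    · rw [div_mul_cancel₀ _ (by positivity)]
      intro s hs1 hs2
      have : 0 < s := lt_of_lt_of_le (by positivity) hs1
      have m1 : min (r / 2) (ε * (r0 / 3)) ≤ r / 2 := min_le_left _ _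
      exact hcs s this (by linarith)
  · rw [min_eq_right h]
    obtain ⟨r, hr, hcs⟩ := hdc_large δ δ' hε
    have hL : 0 < 2 * r * Real.exp N ^ 3 / ε := by positivity
    obtain ⟨x0, hx0, hin⟩ := hd_bigballs hcl hc hk1 hU hk hne hkinf (r := 2 * (2 * r * Real.exp N ^ 3 / ε)) (by positivity)
    refine ⟨x0, hx0, 2 * r, 2 * r * Real.exp N ^ 3 / ε, by positivity, hL, hin, ?_, ?_⟩
    · rw [mul_div_cancel₀ _ hε.ne']
    · intro s hs _
      exact hcs s (by linarith)

/-- Optimality of the Hardy constant when the dimension at infinity of `K` equals its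
affine dimension (Theorem 4.6 of the paper).  The `k`-dimensional volume of `K ∩ B_r`
is expressed via the `k`-dimensional Hausdorff measure. -/
theorem hardy_optimal_constant_full_dim_at_infinity
    (d k : ℕ) (hd : 1 ≤ d) (K : Set (EuclideanSpace ℝ (Fin d)))
    (hKne : K.Nonempty) (hKcl : IsClosed K) (hKconv : Convex ℝ K)
    (hKproper : K ≠ Set.univ)
    (hk : Module.finrank ℝ (affineSpan ℝ K).direction = k)
    (hk1 : 1 ≤ k) (hkd : k ≤ d - 1)
    (hkinf : Filter.liminf
        (fun r : ℝ =>
          Real.log ((μH[(k : ℝ)] (K ∩ Metric.ball 0 r)).toReal) / Real.log r)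
        Filter.atTop = (k : ℝ))
    (p δ δ' : ℝ) (hp : 1 < p) (hδ : 0 ≤ δ) (hδ' : 0 ≤ δ')
    (hcond : 0 < (d : ℝ) - k + min δ δ' - p) :
    muP d p δ δ' K = (((d : ℝ) - k + min δ δ' - p) / p) ^ p := by
  have hp0 : 0 < p := by linarith
  set b : ℝ := ((d : ℝ) - k + min δ δ' - p) / p with hb
  have hb0 : 0 < b := by positivity
  have hU : ∀ x ∈ K, ∀ y ∈ K, x - y ∈ (affineSpan ℝ K).direction := fun x hx y hy =>
    AffineSubspace.vsub_mem_direction (subset_affineSpan ℝ K hx) (subset_affineSpan ℝ K hy)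
  have hsum := Submodule.finrank_add_finrank_orthogonal (affineSpan ℝ K).direction
  rw [hk, finrank_euclideanSpace_fin] at hsum
  have hn : 1 ≤ Module.finrank ℝ ((affineSpan ℝ K).direction)ᗮ := by omega
  have hnr : (Module.finrank ℝ ((affineSpan ℝ K).direction)ᗮ : ℝ) = d - k := by
    have hs2 : ((k + Module.finrank ℝ ((affineSpan ℝ K).direction)ᗮ : ℕ) : ℝ) = d := congrArg _ hsum
    push_cast at hs2; linarith
  have hbp : (b + 1) * p = min δ δ' + Module.finrank ℝ ((affineSpan ℝ K).direction)ᗮ := by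
    rw [hnr, hb]; field_simp; ring
  have hgrad : ∀ (φ : EuclideanSpace ℝ (Fin d) → ℝ) x, ‖gradient φ x‖ = ‖fderiv ℝ φ x‖ := by
    intro φ x
    rw [gradient, LinearIsometryEquiv.norm_map]
  have hfam := fun ε N (hε : (0:ℝ) < ε) => hd_family hKcl hKconv hk1 hk hU hKne hkinf δ δ' ε N hε
  have hup : ∀ B, b ^ p < B → ∃ r ∈ { r : ℝ | ∃ φ : EuclideanSpace ℝ (Fin d) → ℝ,
    ContDiff ℝ 1 φ ∧ HasCompactSupport φ ∧ tsupport φ ⊆ Kᶜ ∧ φ ≠ 0 ∧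
    r = (∫ x in Kᶜ,
          (Metric.infDist x K ^ δ * (1 + Metric.infDist x K) ^ (δ' - δ)) *
            ‖gradient φ x‖ ^ p) /
        (∫ x in Kᶜ,
          (Metric.infDist x K ^ δ * (1 + Metric.infDist x K) ^ (δ' - δ)) *
            Metric.infDist x K ^ (-p) * |φ x| ^ p) }, r ≤ B := by
    intro B hB
    obtain ⟨φ, h1, h2, h3, h4, h5⟩ := hd_upper volume (m := min δ δ') (c := hdc δ δ') hKcl hU hn hb0 hp hbp (hdc_cont δ δ')
      (fun ε N hε _ _ => hfam ε N hε) hB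
    refine ⟨_, ⟨φ, h1, h2, h3, h4, rfl⟩, ?_⟩
    have hl := (hd_lower volume hKne hKcl hKconv hU hb0 hp hbp h1 h2 h3 h4).1
    simp only [hgrad]
    simp only [hdc] at h5 hl
    rw [div_le_iff₀ hl]
    exact h5
  have hlow : ∀ r ∈ { r : ℝ | ∃ φ : EuclideanSpace ℝ (Fin d) → ℝ,
    ContDiff ℝ 1 φ ∧ HasCompactSupport φ ∧ tsupport φ ⊆ Kᶜ ∧ φ ≠ 0 ∧
    r = (∫ x in Kᶜ,
          (Metric.infDist x K ^ δ * (1 + Metric.infDist x K) ^ (δ' - δ)) *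
            ‖gradient φ x‖ ^ p) /
        (∫ x in Kᶜ,
          (Metric.infDist x K ^ δ * (1 + Metric.infDist x K) ^ (δ' - δ)) *
            Metric.infDist x K ^ (-p) * |φ x| ^ p) }, b ^ p ≤ r := by
    rintro r ⟨φ, h1, h2, h3, h4, rfl⟩
    obtain ⟨hl1, hl2⟩ := hd_lower volume hKne hKcl hKconv hU hb0 hp hbp h1 h2 h3 h4
    simp only [hgrad]
    simp only [hdc] at hl1 hl2
    rw [le_div_iff₀ hl1]
    exact hl2
  unfold muP
  apply le_antisymm
  · refine le_of_forall_gt_imp_ge_of_dense ?_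
    intro B hB
    obtain ⟨r, hr, hrB⟩ := hup B hB
    exact (csInf_le ⟨_, hlow⟩ hr).trans hrB
  · obtain ⟨r, hr, _⟩ := hup (b ^ p + 1) (by linarith)
    exact le_csInf ⟨r, hr⟩ hlow
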